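/- There exists a set X ⊆ ℕ that is high for tight descending sequences but not high for paths: every ill-founded computable linear order has an X-computable tight descending sequence, yet some ill-founded computable tree has no X-computable path. (The paper states this as: there is a degree high for tight descending sequences but not high for isomorphism; high for isomorphism coincides with high for paths.) -/

import Mathlib

namespace CFT

open Nat.Partrec (Code)

/-- Relativized partial recursive functions: `f` is partial recursive in the
(total) oracle `O : ℕ → ℕ`.  This mirrors Mathlib's `Nat.Partrec`, with an
extra constructor for the oracle. -/
inductive RecursiveIn (O : ℕ → ℕ) : (ℕ →. ℕ) → Prop
  | zero : RecursiveIn O (pure 0)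
  | succ : RecursiveIn O Nat.succ
  | left : RecursiveIn O ↑fun n : ℕ => n.unpair.1
  | right : RecursiveIn O ↑fun n : ℕ => n.unpair.2
  | oracle : RecursiveIn O ↑O
  | pair {f g} : RecursiveIn O f → RecursiveIn O g →
      RecursiveIn O fun n => Nat.pair <$> f n <*> g n
  | comp {f g} : RecursiveIn O f → RecursiveIn O g →
      RecursiveIn O fun n => g n >>= f
  | prec {f g} : RecursiveIn O f → RecursiveIn O g →
      RecursiveIn O (Nat.unpaired fun a n =>
        n.rec (f a) fun y IH => do let i ← IH; g (Nat.pair a (Nat.pair y i)))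
  | rfind {f} : RecursiveIn O f →
      RecursiveIn O fun a => Nat.rfind fun n => (fun m => m = 0) <$> f (Nat.pair a n)

/-- Partial functions between `Primcodable` types that are partial recursive in
the oracle `O`. -/
def PartrecIn (O : ℕ → ℕ) {α σ : Type} [Primcodable α] [Primcodable σ] (f : α →. σ) : Prop :=
  RecursiveIn O fun n =>
    Part.bind (Part.ofOption (Encodable.decode (α := α) n)) fun a => (f a).map Encodable.encode

/-- Total functions between `Primcodable` types that are computable in the oracle `O`. -/
def ComputableIn (O : ℕ → ℕ) {α σ : Type} [Primcodable α] [Primcodable σ] (f : α → σ) : Prop :=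
  PartrecIn O (f : α →. σ)

open Classical in
/-- The characteristic function of a set of naturals. -/
noncomputable def chi (A : Set ℕ) : ℕ → ℕ := fun n => if n ∈ A then 1 else 0

/-- `A` is computably enumerable in (the characteristic function of) `X`. -/
def CEIn (X : Set ℕ) (A : Set ℕ) : Prop :=
  ∃ f : ℕ →. ℕ, PartrecIn (chi X) f ∧ ∀ n, n ∈ A ↔ (f n).Dom

/-- The `e`-th partial computable function `ℕ →. ℕ`. -/
def codeFn (e : ℕ) : ℕ →. ℕ := (Denumerable.ofNat Code e).eval

/-! ### Trees on ℕ -/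

def PrefixClosed (T : Set (List ℕ)) : Prop := ∀ l ∈ T, ∀ l' : List ℕ, l' <+: l → l' ∈ T

/-- Index `e` decides a (prefix-closed) tree on `ℕ`. -/
def DecidesTree (e : ℕ) : Prop :=
  (∀ n, (codeFn e n).Dom) ∧
    PrefixClosed {l : List ℕ | codeFn e (Encodable.encode l) = Part.some 1}

open Classical in
/-- The standard enumeration of computable trees on ℕ; indices that do not
decide a tree denote the empty tree. -/
noncomputable def treeAt (e : ℕ) : Set (List ℕ) :=
  if DecidesTree e then {l : List ℕ | codeFn e (Encodable.encode l) = Part.some 1} else ∅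

/-- `f` is a path through the tree `T`: every finite initial segment
`[f 0, …, f (k-1)]` is in `T`. -/
def IsPath (T : Set (List ℕ)) (f : ℕ → ℕ) : Prop := ∀ k, (List.range k).map f ∈ T

def IllFounded (T : Set (List ℕ)) : Prop := ∃ f, IsPath T f

/-- The set of indices of well-founded computable trees. -/
def WF : Set ℕ := {e | ¬ IllFounded (treeAt e)}

/-- `T` is a computable tree (prefix-closed and decided by a total computable function). -/
def ComputableTree (T : Set (List ℕ)) : Prop :=
  PrefixClosed T ∧ ∃ χ : List ℕ → Bool, Computable χ ∧ ∀ l, l ∈ T ↔ χ l = true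

/-! ### Highness notions for paths -/

def HighForPaths (X : Set ℕ) : Prop :=
  ∀ T : Set (List ℕ), ComputableTree T → IllFounded T →
    ∃ f : ℕ → ℕ, ComputableIn (chi X) f ∧ IsPath T f

def LoqHighForPaths (X : Set ℕ) : Prop :=
  ∃ F : ℕ × ℕ → ℕ, ComputableIn (chi X) F ∧
    ∀ e, IllFounded (treeAt e) → IsPath (treeAt e) fun n => F (e, n)

def UnifHighForPaths (X : Set ℕ) : Prop :=
  ∃ F : ℕ × ℕ →. ℕ, PartrecIn (chi X) F ∧
    ∀ e, IllFounded (treeAt e) →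
      ∃ g : ℕ → ℕ, IsPath (treeAt e) g ∧ ∀ n, F (e, n) = Part.some (g n)

def RetHighForPaths (X : Set ℕ) : Prop :=
  ∃ F : ℕ × ℕ →. ℕ, PartrecIn (chi X) F ∧
    (∀ e, IllFounded (treeAt e) →
      ∃ g : ℕ → ℕ, IsPath (treeAt e) g ∧ ∀ n, F (e, n) = Part.some (g n)) ∧
    (∀ e, ¬ IllFounded (treeAt e) → ∀ n, ¬ (F (e, n)).Dom)

/-! ### Σ¹₁ and Π¹₁ sets -/

def Sigma11 (A : Set ℕ) : Prop :=
  ∃ R : ℕ → List ℕ → Bool, Computable₂ R ∧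
    ∀ n, n ∈ A ↔ ∃ f : ℕ → ℕ, ∀ k, R n ((List.range k).map f) = true

def Pi11 (A : Set ℕ) : Prop := Sigma11 Aᶜ

/-! ### Linear orders -/

/-- A (presentation of a) linear order: a domain `D ⊆ ℕ` and a strict order
relation on it. -/
structure LinOrd where
  dom : Set ℕ
  lt : ℕ → ℕ → Prop

/-- `L` really is a strict linear order on its domain. -/
def LinOrd.IsValid (L : LinOrd) : Prop :=
  (∀ a b, L.lt a b → a ∈ L.dom ∧ b ∈ L.dom) ∧
  (∀ a, ¬ L.lt a a) ∧
  (∀ a b c, L.lt a b → L.lt b c → L.lt a c) ∧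
  (∀ a ∈ L.dom, ∀ b ∈ L.dom, a = b ∨ L.lt a b ∨ L.lt b a)

def linOrdOfCodes (n : ℕ) : LinOrd :=
  ⟨{a | codeFn n.unpair.1 a = Part.some 1},
   fun a b => codeFn n.unpair.2 (Nat.pair a b) = Part.some 1⟩

def DecidesLinOrd (n : ℕ) : Prop :=
  (∀ m, (codeFn n.unpair.1 m).Dom) ∧ (∀ m, (codeFn n.unpair.2 m).Dom) ∧
    (linOrdOfCodes n).IsValid

open Classical in
/-- The standard enumeration of computable linear orders; indices that do not
decide a linear order denote the empty order. -/
noncomputable def linOrdAt (n : ℕ) : LinOrd :=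
  if DecidesLinOrd n then linOrdOfCodes n else ⟨∅, fun _ _ => False⟩

def IsDescSeq (L : LinOrd) (f : ℕ → ℕ) : Prop :=
  ∀ i, f i ∈ L.dom ∧ L.lt (f (i + 1)) (f i)

def LinOrd.IllFounded (L : LinOrd) : Prop := ∃ f, IsDescSeq L f

/-- A tight descending sequence: a descending sequence that gets below every
descending sequence. -/
def IsTightDescSeq (L : LinOrd) (f : ℕ → ℕ) : Prop :=
  IsDescSeq L f ∧ ∀ g, IsDescSeq L g → ∀ n, ∃ m, L.lt (f m) (g n)

/-- `L` is a computable linear order. -/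
def ComputableLinOrd (L : LinOrd) : Prop :=
  L.IsValid ∧
  (∃ χ : ℕ → Bool, Computable χ ∧ ∀ a, a ∈ L.dom ↔ χ a = true) ∧
  (∃ χ : ℕ → ℕ → Bool, Computable₂ χ ∧ ∀ a b, L.lt a b ↔ χ a b = true)

def LoqHighForDS (X : Set ℕ) : Prop :=
  ∃ g : ℕ × ℕ → ℕ, ComputableIn (chi X) g ∧
    ∀ n, (linOrdAt n).IllFounded → IsDescSeq (linOrdAt n) fun k => g (n, k)

def HighForTightDS (X : Set ℕ) : Prop :=
  ∀ L : LinOrd, ComputableLinOrd L → L.IllFounded →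
    ∃ f : ℕ → ℕ, ComputableIn (chi X) f ∧ IsTightDescSeq L f

def UnifHighForTightDS (X : Set ℕ) : Prop :=
  ∃ F : ℕ × ℕ →. ℕ, PartrecIn (chi X) F ∧
    ∀ n, (linOrdAt n).IllFounded →
      ∃ g : ℕ → ℕ, IsTightDescSeq (linOrdAt n) g ∧ ∀ k, F (n, k) = Part.some (g k)

/-! ### Binary trees -/

def PrefixClosedB (B : Set (List Bool)) : Prop := ∀ l ∈ B, ∀ l' : List Bool, l' <+: l → l' ∈ B

def DecidesBTree (e : ℕ) : Prop :=
  (∀ n, (codeFn e n).Dom) ∧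
    PrefixClosedB {l : List Bool | codeFn e (Encodable.encode l) = Part.some 1}

open Classical in
/-- The standard enumeration of computable binary trees; indices that do not
decide a binary tree denote the full binary tree. -/
noncomputable def bTreeAt (e : ℕ) : Set (List Bool) :=
  if DecidesBTree e then {l : List Bool | codeFn e (Encodable.encode l) = Part.some 1}
  else Set.univ

def BInfinite (B : Set (List Bool)) : Prop := ∀ k, ∃ l ∈ B, l.length = k

def IsBPath (B : Set (List Bool)) (p : ℕ → Bool) : Prop := ∀ k, (List.range k).map p ∈ B

/-! ### Decidable predicates -/

section Decidable

variable {α β : Type} [Primcodable α] [Primcodable β] {p q : α → Prop}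

theorem computablePred_iff : ComputablePred p ↔
    ∃ χ : α → Bool, Computable χ ∧ ∀ a, p a ↔ χ a = true :=
  ComputablePred.computable_iff.trans
    ⟨fun ⟨χ, h, e⟩ => ⟨χ, h, fun a => by rw [e]⟩, fun ⟨χ, h, e⟩ => ⟨χ, h, funext fun a => propext (e a)⟩⟩

theorem computablePred_comp (hp : ComputablePred p) {f : β → α} (hf : Computable f) :
    ComputablePred fun b => p (f b) := by
  obtain ⟨χ, h, e⟩ := computablePred_iff.1 hp
  exact computablePred_iff.2 ⟨_, h.comp hf, fun b => e _⟩

theorem computablePred_and (hp : ComputablePred p) (hq : ComputablePred q) :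
    ComputablePred fun a => p a ∧ q a := by
  obtain ⟨χ, h, e⟩ := computablePred_iff.1 hp
  obtain ⟨χ', h', e'⟩ := computablePred_iff.1 hq
  exact computablePred_iff.2 ⟨_, Primrec.and.to_comp.comp h h', fun b => by simp [e, e']⟩

theorem computablePred_or (hp : ComputablePred p) (hq : ComputablePred q) :
    ComputablePred fun a => p a ∨ q a := by
  obtain ⟨χ, h, e⟩ := computablePred_iff.1 hp
  obtain ⟨χ', h', e'⟩ := computablePred_iff.1 hq
  exact computablePred_iff.2 ⟨_, Primrec.or.to_comp.comp h h', fun b => by simp [e, e']⟩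

theorem computablePred_imp (hp : ComputablePred p) (hq : ComputablePred q) :
    ComputablePred fun a => p a → q a :=
  (computablePred_or hp.not hq).of_eq fun a => by tauto

theorem computablePred_eq {f g : α → β} (hf : Computable f) (hg : Computable g) :
    ComputablePred fun a => f a = g a :=
  (computablePred_comp (Primrec.eq (α := ℕ)).computablePred
    ((Computable.encode.comp hf).pair (Computable.encode.comp hg))).of_eq fun a => by simp

theorem computablePred_lt {f g : α → ℕ} (hf : Computable f) (hg : Computable g) :
    ComputablePred fun a => f a < g a :=
  computablePred_comp (Primrec.nat_lt.computablePred) (hf.pair hg)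

theorem computablePred_le {f g : α → ℕ} (hf : Computable f) (hg : Computable g) :
    ComputablePred fun a => f a ≤ g a :=
  computablePred_comp (Primrec.nat_le.computablePred) (hf.pair hg)

theorem computablePred_forall_lt {n : α → ℕ} (hn : Computable n) {r : α × ℕ → Prop}
    (hr : ComputablePred r) : ComputablePred fun a => ∀ i < n a, r (a, i) := by
  obtain ⟨χ, h, e⟩ := computablePred_iff.1 hr
  refine computablePred_iff.2 ⟨fun a => Nat.rec true (fun i b => b && χ (a, i)) (n a), ?_, ?_⟩
  · refine Computable.nat_rec hn (Computable.const true) (h := fun a p => p.2 && χ (a, p.1)) ?_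
    exact Primrec.and.to_comp.comp (Computable.snd.comp Computable.snd)
      (h.comp (Computable.fst.pair (Computable.fst.comp Computable.snd)))
  · intro a
    beta_reduce
    generalize n a = m
    induction m with
    | zero => simp
    | succ m ih =>
      rw [Nat.forall_lt_succ_right, ih]
      simp [e]

end Decidable

/-! ### Lightface `Σ¹₁` predicates on coded types -/

section Sig

variable {α β : Type} [Primcodable α] [Primcodable β]

/-- The initial segment of `f` of length `k`. -/
def pre (f : ℕ → ℕ) (k : ℕ) : List ℕ := (List.range k).map f

@[simp] theorem length_pre (f : ℕ → ℕ) (k : ℕ) : (pre f k).length = k := by simp [pre]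

theorem getD_pre {f : ℕ → ℕ} {k i : ℕ} (h : i < k) : (pre f k).getD i 0 = f i := by
  simp [pre, h]

theorem take_pre {f : ℕ → ℕ} {k i : ℕ} (h : i ≤ k) : (pre f k).take i = pre f i := by
  simp [pre, List.map_take.symm, List.take_range, h]

/-- Lightface `Σ¹₁` predicates. -/
def Sig (A : α → Prop) : Prop :=
  ∃ R : α × List ℕ → Prop, ComputablePred R ∧ ∀ a, A a ↔ ∃ f : ℕ → ℕ, ∀ k, R (a, pre f k)

/-- The instance at stage `l.length.unpair.1` of a condition on the values of a function at the
points `P k`, read off from the initial segment `l`; vacuous while `l` is too short. -/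
def LocalCheck {α : Type} (P : ℕ → List ℕ) (R : α × ℕ × List ℕ → Prop) (x : α × List ℕ) : Prop :=
  (∀ i ∈ P x.2.length.unpair.1, i < x.2.length) →
    R (x.1, x.2.length.unpair.1, (P x.2.length.unpair.1).map fun i => x.2.getD i 0)

theorem computablePred_localCheck {P : ℕ → List ℕ} {R : α × ℕ × List ℕ → Prop}
    (hP : Computable P) (hR : ComputablePred R) : ComputablePred (LocalCheck P R) := by
  have hlen : Computable fun x : α × List ℕ => x.2.length :=
    Primrec.list_length.to_comp.comp Computable.snd
  have hk : Computable fun x : α × List ℕ => x.2.length.unpair.1 :=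
    Computable.fst.comp (Computable.unpair.comp hlen)
  have hPk := hP.comp hk
  refine computablePred_imp ?_ (computablePred_comp hR (Computable.fst.pair (hk.pair ?_)))
  · exact computablePred_comp
      (Primrec.nat_lt.forall_mem_list.computablePred) (hPk.pair hlen)
  · have : Primrec₂ fun (L l : List ℕ) => L.map fun i => l.getD i 0 :=
      Primrec.list_map Primrec.fst ((Primrec.list_getD 0).comp (Primrec.snd.comp Primrec.fst)
        Primrec.snd).to₂
    exact this.to_comp.comp hPk Computable.snd

theorem forall_localCheck {α : Type} {P : ℕ → List ℕ} {R : α × ℕ × List ℕ → Prop} {a : α} {f : ℕ → ℕ} :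
    (∀ k, LocalCheck P R (a, pre f k)) ↔ ∀ k, R (a, k, (P k).map f) := by
  have key (k) (h : ∀ i ∈ P k.unpair.1, i < k) :
      (P k.unpair.1).map (fun i => (pre f k).getD i 0) = (P k.unpair.1).map f :=
    List.map_congr_left fun i hi => getD_pre (h i hi)
  constructor
  · intro H k
    obtain ⟨j, hj⟩ : ∃ j, ∀ i ∈ P k, i < j :=
      ⟨(P k).sum + 1, fun i hi => Nat.lt_succ_of_le (List.le_sum_of_mem hi)⟩
    have hb : ∀ i ∈ P (Nat.pair k j).unpair.1, i < Nat.pair k j := by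
      simpa using fun i hi => (hj i hi).trans_le (Nat.right_le_pair k j)
    have := H (Nat.pair k j) (by simpa [LocalCheck] using hb)
    simp only [length_pre] at this
    rw [key _ hb] at this
    simpa using this
  · intro H k h
    simp only [length_pre] at h ⊢
    rw [key _ h]
    exact H _

theorem sig_of_points {A : α → Prop} {P : ℕ → List ℕ} {R : α × ℕ × List ℕ → Prop}
    (hP : Computable P) (hR : ComputablePred R)
    (h : ∀ a, A a ↔ ∃ f : ℕ → ℕ, ∀ k, R (a, k, (P k).map f)) : Sig A :=
  ⟨LocalCheck P R, computablePred_localCheck hP hR, fun a => by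
    simp only [h, forall_localCheck]⟩

theorem sig_of_computablePred {A : α → Prop} (h : ComputablePred A) : Sig A :=
  ⟨fun x => A x.1, computablePred_comp h Computable.fst, fun a => by simp⟩

theorem Sig.of_iff {A B : α → Prop} (h : Sig A) (e : ∀ a, B a ↔ A a) : Sig B := by
  rwa [show B = A from funext fun a => propext (e a)]

theorem Sig.comp {A : α → Prop} (h : Sig A) {f : β → α} (hf : Computable f) :
    Sig fun b => A (f b) := by
  obtain ⟨R, hR, e⟩ := h
  exact ⟨fun x => R (f x.1, x.2), computablePred_comp hR
    ((hf.comp Computable.fst).pair Computable.snd), fun b => e _⟩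

theorem Sig.exists {A : α × β → Prop} (h : Sig A) : Sig fun a => ∃ b, A (a, b) := by
  obtain ⟨R, hR, e⟩ := h
  obtain ⟨χ, hχ, eχ⟩ := computablePred_iff.1 hR
  let R' : α × ℕ × List ℕ → Bool := fun x =>
    ((Encodable.decode (α := β) (x.2.2.headI)).map fun b => χ ((x.1, b), x.2.2.tail)).getD false
  have hR' : Computable R' := by
    refine Computable.option_getD (Computable.option_map (Computable.decode.comp ?_) ?_)
      (Computable.const false)
    · exact Primrec.list_headI.to_comp.comp (Computable.snd.comp Computable.snd)
    · exact (hχ.comp (((Computable.fst.comp Computable.fst).pair Computable.snd).pair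
        (Primrec.list_tail.to_comp.comp
          (Computable.snd.comp (Computable.snd.comp Computable.fst))))).to₂
  refine sig_of_points (P := fun k => List.range (k + 1)) (R := fun x => R' x = true)
    (Primrec.list_range.to_comp.comp Computable.succ) (computablePred_iff.2 ⟨_, hR', by simp⟩) ?_
  intro a
  have hl (f : ℕ → ℕ) (k : ℕ) :
      (List.range (k + 1)).map f = f 0 :: pre (fun i => f (i + 1)) k := by
    simp [pre, List.range_succ_eq_map, Function.comp_def]
  simp only [hl, R', List.headI, List.tail_cons, e]
  constructor
  · rintro ⟨b, f, hf⟩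
    refine ⟨fun i => i.casesOn (Encodable.encode b) f, fun k => ?_⟩
    simpa [← eχ] using hf k
  · rintro ⟨f, hf⟩
    cases hd : Encodable.decode (α := β) (f 0) with
    | none => simpa [hd] using hf 0
    | some b =>
      refine ⟨b, fun i => f (i + 1), fun k => ?_⟩
      simpa [hd, ← eχ] using hf k

theorem Sig.forall {A : α × β → Prop} (h : Sig A) : Sig fun a => ∀ b, A (a, b) := by
  obtain ⟨R, hR, e⟩ := h
  obtain ⟨χ, hχ, eχ⟩ := computablePred_iff.1 hR
  let R' : α × ℕ × List ℕ → Bool := fun x =>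
    ((Encodable.decode (α := β) (x.2.1.unpair.1)).map fun b => χ ((x.1, b), x.2.2)).getD true
  have hR' : Computable R' := by
    refine Computable.option_getD (Computable.option_map (Computable.decode.comp ?_) ?_)
      (Computable.const true)
    · exact Computable.fst.comp (Computable.unpair.comp (Computable.fst.comp Computable.snd))
    · exact (hχ.comp (((Computable.fst.comp Computable.fst).pair Computable.snd).pair
          (Computable.snd.comp (Computable.snd.comp Computable.fst)))).to₂
  refine sig_of_points (P := fun k => (List.range k.unpair.2).map (Nat.pair k.unpair.1))
    (R := fun x => R' x = true) ?_ (computablePred_iff.2 ⟨_, hR', by simp⟩) ?_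
  · refine Primrec.to_comp (Primrec.list_map (Primrec.list_range.comp
      (Primrec.snd.comp Primrec.unpair)) ?_)
    exact (Primrec₂.natPair.comp (Primrec.fst.comp (Primrec.unpair.comp Primrec.fst))
      Primrec.snd).to₂
  intro a
  have hl (f : ℕ → ℕ) (i k : ℕ) :
      ((List.range k).map (Nat.pair i)).map f = pre (fun j => f (Nat.pair i j)) k := by
    simp [pre, Function.comp_def]
  simp only [hl, R', e]
  constructor
  · intro H
    choose f hf using H
    refine ⟨fun m => ((Encodable.decode (α := β) m.unpair.1).map
      fun b => f b m.unpair.2).getD 0, fun k => ?_⟩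
    cases hd : Encodable.decode (α := β) k.unpair.1 with
    | none => simp
    | some b => simpa [hd, ← eχ] using hf b k.unpair.2
  · rintro ⟨f, hf⟩ b
    refine ⟨fun j => f (Nat.pair (Encodable.encode b) j), fun k => ?_⟩
    simpa [← eχ] using hf (Nat.pair (Encodable.encode b) k)

theorem Sig.ite {c A B : α → Prop} (hc : ComputablePred c) (hA : Sig A) (hB : Sig B) :
    Sig fun a => (c a → A a) ∧ (¬ c a → B a) := by
  obtain ⟨R, hR, e⟩ := hA
  obtain ⟨S, hS, e'⟩ := hB
  refine ⟨fun x => (c x.1 → R x) ∧ (¬ c x.1 → S x), ?_, fun a => ?_⟩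
  · have := computablePred_comp hc (Computable.fst (α := α) (β := List ℕ))
    exact computablePred_and (computablePred_imp this hR) (computablePred_imp this.not hS)
  · by_cases h : c a <;> simp [h, e, e']

theorem computablePred_snd_bool : ComputablePred fun x : α × Bool => x.2 = true :=
  computablePred_iff.2 ⟨_, Computable.snd, fun _ => Iff.rfl⟩

theorem Sig.and {A B : α → Prop} (hA : Sig A) (hB : Sig B) : Sig fun a => A a ∧ B a :=
  (Sig.forall (Sig.ite computablePred_snd_bool (hA.comp Computable.fst)
    (hB.comp Computable.fst))).of_iff fun a => by simp [and_comm]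

theorem Sig.or {A B : α → Prop} (hA : Sig A) (hB : Sig B) : Sig fun a => A a ∨ B a :=
  (Sig.exists (Sig.ite computablePred_snd_bool (hA.comp Computable.fst)
    (hB.comp Computable.fst))).of_iff fun a => by simp [or_comm]

/-- Predicates that are `Σ¹₁` together with their negation. -/
def Delta (A : α → Prop) : Prop := Sig A ∧ Sig fun a => ¬ A a

theorem delta_of_computablePred {A : α → Prop} (h : ComputablePred A) : Delta A :=
  ⟨sig_of_computablePred h, sig_of_computablePred h.not⟩

theorem Delta.not {A : α → Prop} (h : Delta A) : Delta fun a => ¬ A a :=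
  ⟨h.2, by simpa using h.1⟩

theorem Delta.of_iff {A B : α → Prop} (h : Delta A) (e : ∀ a, B a ↔ A a) : Delta B := by
  rwa [show B = A from funext fun a => propext (e a)]

theorem Delta.comp {A : α → Prop} (h : Delta A) {f : β → α} (hf : Computable f) :
    Delta fun b => A (f b) := ⟨h.1.comp hf, h.2.comp hf⟩

theorem Delta.and {A B : α → Prop} (hA : Delta A) (hB : Delta B) : Delta fun a => A a ∧ B a :=
  ⟨hA.1.and hB.1, (hA.2.or hB.2).of_iff fun a => by tauto⟩

theorem Delta.imp {A B : α → Prop} (hA : Delta A) (hB : Delta B) : Delta fun a => A a → B a :=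
  ⟨(hA.2.or hB.1).of_iff fun a => by tauto, (hA.1.and hB.2).of_iff fun a => by tauto⟩

theorem Delta.exists {A : α × β → Prop} (h : Delta A) : Delta fun a => ∃ b, A (a, b) :=
  ⟨h.1.exists, h.2.forall.of_iff fun a => by simp⟩

theorem Delta.forall {A : α × β → Prop} (h : Delta A) : Delta fun a => ∀ b, A (a, b) :=
  ⟨h.1.forall, h.2.exists.of_iff fun a => by simp⟩

/-- Membership in the value of a partial recursive function is arithmetical. -/
theorem delta_mem_partrec {F : α →. β} (hF : Partrec F) :
    Delta fun x : α × β => x.2 ∈ F x.1 := by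
  obtain ⟨c, hc⟩ := Nat.Partrec.Code.exists_code.1 hF
  have key : ComputablePred fun y : (α × β) × ℕ =>
      Nat.Partrec.Code.evaln y.2 c (Encodable.encode y.1.1) = some (Encodable.encode y.1.2) := by
    refine computablePred_eq ?_ ?_
    · exact Nat.Partrec.Code.primrec_evaln.to_comp.comp
        ((Computable.snd.pair (Computable.const c)).pair
          (Computable.encode.comp (Computable.fst.comp Computable.fst)))
    · exact Computable.option_some.comp
        (Computable.encode.comp (Computable.snd.comp Computable.fst))
  refine (delta_of_computablePred key).exists.of_iff fun x => ?_
  have : Encodable.encode x.2 ∈ c.eval (Encodable.encode x.1) ↔ x.2 ∈ F x.1 := by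
    rw [hc]; simp
  rw [← this, Nat.Partrec.Code.evaln_complete]
  rfl

end Sig

/-! ### Oracle programs -/

/-- Programs for functions that are partial recursive in an oracle. -/
inductive OCode : Type
  | zero : OCode
  | succ : OCode
  | left : OCode
  | right : OCode
  | oracle : OCode
  | pair : OCode → OCode → OCode
  | comp : OCode → OCode → OCode
  | prec : OCode → OCode → OCode
  | rfind : OCode → OCode

namespace OCode

/-- A Gödel numbering of the programs. -/
def toNat : OCode → ℕ
  | zero => Nat.pair 0 0
  | succ => Nat.pair 1 0
  | left => Nat.pair 2 0
  | right => Nat.pair 3 0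
  | oracle => Nat.pair 4 0
  | pair a b => Nat.pair 5 (Nat.pair a.toNat b.toNat)
  | comp a b => Nat.pair 6 (Nat.pair a.toNat b.toNat)
  | prec a b => Nat.pair 7 (Nat.pair a.toNat b.toNat)
  | rfind a => Nat.pair 8 a.toNat

theorem toNat_injective : Function.Injective toNat := by
  intro a
  induction a with
  | pair a b iha ihb | comp a b iha ihb | prec a b iha ihb =>
    rintro (_ | _ | _ | _ | _ | _ | _ | _ | _) h <;> simp [toNat, Nat.pair_eq_pair] at h ⊢
    exact ⟨iha h.1, ihb h.2⟩
  | rfind a iha =>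
    rintro (_ | _ | _ | _ | _ | _ | _ | _ | _) h <;> simp [toNat, Nat.pair_eq_pair] at h ⊢
    exact iha h
  | _ => rintro (_ | _ | _ | _ | _ | _ | _ | _ | _) h <;> simp [toNat, Nat.pair_eq_pair] at h ⊢

instance : Countable OCode := toNat_injective.countable

/-- The partial function computed by a program from a partial oracle. -/
def eval (p : ℕ →. ℕ) : OCode → ℕ →. ℕ
  | zero => pure 0
  | succ => Nat.succ
  | left => ↑fun n : ℕ => n.unpair.1
  | right => ↑fun n : ℕ => n.unpair.2
  | oracle => p
  | pair a b => fun n => Nat.pair <$> eval p a n <*> eval p b n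
  | comp a b => fun n => eval p b n >>= eval p a
  | prec a b => Nat.unpaired fun m n =>
      n.rec (eval p a m) fun y IH => do let i ← IH; eval p b (Nat.pair m (Nat.pair y i))
  | rfind a => fun m => Nat.rfind fun n => (fun v => v = 0) <$> eval p a (Nat.pair m n)

end OCode

open OCode

theorem RecursiveIn.exists_oCode {O : ℕ → ℕ} {f : ℕ →. ℕ} (h : RecursiveIn O f) :
    ∃ c : OCode, c.eval (O : ℕ →. ℕ) = f := by
  induction h with
  | zero => exact ⟨OCode.zero, rfl⟩
  | succ => exact ⟨OCode.succ, rfl⟩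
  | left => exact ⟨OCode.left, rfl⟩
  | right => exact ⟨OCode.right, rfl⟩
  | oracle => exact ⟨OCode.oracle, rfl⟩
  | pair _ _ ha hb =>
    obtain ⟨a, rfl⟩ := ha; obtain ⟨b, rfl⟩ := hb; exact ⟨OCode.pair a b, rfl⟩
  | comp _ _ ha hb =>
    obtain ⟨a, rfl⟩ := ha; obtain ⟨b, rfl⟩ := hb; exact ⟨OCode.comp a b, rfl⟩
  | prec _ _ ha hb =>
    obtain ⟨a, rfl⟩ := ha; obtain ⟨b, rfl⟩ := hb; exact ⟨OCode.prec a b, rfl⟩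
  | rfind _ ha => obtain ⟨a, rfl⟩ := ha; exact ⟨OCode.rfind a, rfl⟩

theorem ComputableIn.recursiveIn {O : ℕ → ℕ} {f : ℕ → ℕ} (h : ComputableIn O f) :
    RecursiveIn O (f : ℕ →. ℕ) := by
  have : (fun n => Part.bind (Part.ofOption (Encodable.decode (α := ℕ) n)) fun a =>
      ((f : ℕ →. ℕ) a).map Encodable.encode) = (f : ℕ →. ℕ) := by
    funext n; simp
  rw [← this]; exact h

theorem RecursiveIn.computableIn {O : ℕ → ℕ} {f : ℕ → ℕ} (h : RecursiveIn O (f : ℕ →. ℕ)) :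
    ComputableIn O f := by
  have : (fun n => Part.bind (Part.ofOption (Encodable.decode (α := ℕ) n)) fun a =>
      ((f : ℕ →. ℕ) a).map Encodable.encode) = (f : ℕ →. ℕ) := by
    funext n; simp
  unfold ComputableIn PartrecIn
  rw [this]; exact h

theorem OCode.mem_eval_rfind {p : ℕ →. ℕ} {a : OCode} {n v : ℕ} :
    v ∈ (rfind a).eval p n ↔ (∃ x ∈ a.eval p (Nat.pair n v), decide (x = 0) = true) ∧
      ∀ {j}, j < v → ∃ x ∈ a.eval p (Nat.pair n j), decide (x = 0) = false := by
  refine Nat.mem_rfind.trans ?_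
  simp [Part.mem_map_iff]

/-- A convergent computation only uses a finite part of its oracle. -/
theorem OCode.exists_use {O : ℕ → ℕ} (c : OCode) {n v : ℕ} (h : v ∈ c.eval (O : ℕ →. ℕ) n) :
    ∃ s, ∀ p : ℕ →. ℕ, (∀ m < s, O m ∈ p m) → v ∈ c.eval p n := by
  induction c generalizing n v with
  | zero => exact ⟨0, fun p _ => h⟩
  | succ => exact ⟨0, fun p _ => h⟩
  | left => exact ⟨0, fun p _ => h⟩
  | right => exact ⟨0, fun p _ => h⟩
  | oracle =>
    refine ⟨n + 1, fun p hp => ?_⟩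
    have : v = O n := by simpa [eval] using h
    exact this ▸ hp n n.lt_succ_self
  | pair a b iha ihb =>
    simp only [eval, Seq.seq, Part.map_eq_map, Part.mem_bind_iff, Part.mem_map_iff,
      exists_exists_and_eq_and] at h ⊢
    obtain ⟨x, hx, y, hy, e⟩ := h
    obtain ⟨s, hs⟩ := iha hx
    obtain ⟨t, ht⟩ := ihb hy
    exact ⟨max s t, fun p hp => ⟨x, hs p fun m hm => hp m (lt_max_of_lt_left hm), y,
      ht p fun m hm => hp m (lt_max_of_lt_right hm), e⟩⟩
  | comp a b iha ihb =>
    obtain ⟨x, hx, hy⟩ := Part.mem_bind_iff.1 h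
    obtain ⟨s, hs⟩ := ihb hx
    obtain ⟨t, ht⟩ := iha hy
    exact ⟨max s t, fun p hp => Part.mem_bind_iff.2 ⟨x,
      hs p fun m hm => hp m (lt_max_of_lt_left hm),
      ht p fun m hm => hp m (lt_max_of_lt_right hm)⟩⟩
  | prec a b iha ihb =>
    simp only [eval, Nat.unpaired] at h ⊢
    generalize n.unpair.2 = k at h ⊢
    induction k generalizing v with
    | zero => exact iha h
    | succ k ih =>
      simp only [Part.bind_eq_bind, Part.mem_bind_iff] at h ⊢
      obtain ⟨x, hx, hy⟩ := h
      obtain ⟨s, hs⟩ := ih hx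
      obtain ⟨t, ht⟩ := ihb hy
      exact ⟨max s t, fun p hp => ⟨x, hs p fun m hm => hp m (lt_max_of_lt_left hm),
        ht p fun m hm => hp m (lt_max_of_lt_right hm)⟩⟩
  | rfind a iha =>
    rw [mem_eval_rfind] at h
    simp only [mem_eval_rfind]
    obtain ⟨⟨x, hx, ex⟩, hlt⟩ := h
    obtain ⟨s, hs⟩ := iha hx
    have : ∀ j, ∃ t, j < v → ∀ p : ℕ →. ℕ, (∀ m < t, O m ∈ p m) →
        ∃ y ∈ a.eval p (Nat.pair n j), decide (y = 0) = false := by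
      intro j
      by_cases hj : j < v
      · obtain ⟨y, hy, ey⟩ := hlt hj
        obtain ⟨t, ht⟩ := iha hy
        exact ⟨t, fun _ p hp => ⟨y, ht p hp, ey⟩⟩
      · exact ⟨0, fun h => absurd h hj⟩
    choose t ht using this
    refine ⟨max s ((Finset.range v).sup t), fun p hp =>
      ⟨⟨x, hs p fun m hm => hp m (lt_max_of_lt_left hm), ex⟩, fun {j} hj => ?_⟩⟩
    exact ht j hj p fun m hm => hp m (lt_max_of_lt_right
      (hm.trans_le (Finset.le_sup (f := t) (Finset.mem_range.2 hj))))

/-- Computations from a partial oracle persist in every extension of the oracle. -/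
theorem OCode.eval_mono {p q : ℕ →. ℕ} (hpq : ∀ m v, v ∈ p m → v ∈ q m) (c : OCode) {n v : ℕ}
    (h : v ∈ c.eval p n) : v ∈ c.eval q n := by
  induction c generalizing n v with
  | zero => exact h
  | succ => exact h
  | left => exact h
  | right => exact h
  | oracle => exact hpq _ _ h
  | pair a b iha ihb =>
    simp only [eval, Seq.seq, Part.map_eq_map, Part.mem_bind_iff, Part.mem_map_iff,
      exists_exists_and_eq_and] at h ⊢
    obtain ⟨x, hx, y, hy, e⟩ := h
    exact ⟨x, iha hx, y, ihb hy, e⟩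
  | comp a b iha ihb =>
    obtain ⟨x, hx, hy⟩ := Part.mem_bind_iff.1 h
    exact Part.mem_bind_iff.2 ⟨x, ihb hx, iha hy⟩
  | prec a b iha ihb =>
    simp only [eval, Nat.unpaired] at h ⊢
    generalize n.unpair.2 = k at h ⊢
    induction k generalizing v with
    | zero => exact iha h
    | succ k ih =>
      simp only [Part.bind_eq_bind, Part.mem_bind_iff] at h ⊢
      obtain ⟨x, hx, hy⟩ := h
      exact ⟨x, ih hx, ihb hy⟩
  | rfind a iha =>
    rw [mem_eval_rfind] at h
    simp only [mem_eval_rfind]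
    obtain ⟨⟨x, hx, ex⟩, hlt⟩ := h
    refine ⟨⟨x, iha hx, ex⟩, fun {j} hj => ?_⟩
    obtain ⟨y, hy, ey⟩ := hlt hj
    exact ⟨y, iha hy, ey⟩

/-- The partial oracle given by a finite binary string. -/
def lookup (τ : List Bool) : ℕ →. ℕ := fun m => ((τ[m]?).map Bool.toNat : Option ℕ)

theorem partrec_eval_lookup (c : OCode) :
    Partrec fun x : List Bool × ℕ => c.eval (lookup x.1) x.2 := by
  induction c with
  | zero => exact (Computable.const 0).partrec
  | succ => exact (Computable.succ.comp Computable.snd).partrec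
  | left => exact (Computable.fst.comp (Computable.unpair.comp Computable.snd)).partrec
  | right => exact (Computable.snd.comp (Computable.unpair.comp Computable.snd)).partrec
  | oracle =>
    refine Computable.ofOption (f := fun x : List Bool × ℕ => (x.1[x.2]?).map Bool.toNat) ?_
    exact Computable.option_map Computable.list_getElem?
      ((Primrec.dom_finite Bool.toNat).to_comp.comp Computable.snd).to₂
  | pair a b iha ihb =>
    refine (iha.bind (g := fun x u => (b.eval (lookup x.1) x.2).map (Nat.pair u))
      ?_).of_eq fun x => ?_
    · exact (Partrec.map (ihb.comp Computable.fst)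
        (g := fun (y : (List Bool × ℕ) × ℕ) v => Nat.pair y.2 v)
        (Primrec₂.natPair.to_comp.comp (Computable.snd.comp Computable.fst) Computable.snd)).to₂
    · ext v; simp [eval, Seq.seq]
  | comp a b iha ihb =>
    have h : Partrec₂ fun (x : List Bool × ℕ) (u : ℕ) => a.eval (lookup x.1) u :=
      (iha.comp ((Computable.fst.comp Computable.fst).pair Computable.snd) :
        Partrec fun y : (List Bool × ℕ) × ℕ => a.eval (lookup y.1.1) y.2)
    exact (ihb.bind h).of_eq fun x => rfl
  | prec a b iha ihb =>
    have hl : Computable fun x : List Bool × ℕ => x.2.unpair.1 :=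
      Computable.fst.comp (Computable.unpair.comp Computable.snd)
    have hr : Computable fun x : List Bool × ℕ => x.2.unpair.2 :=
      Computable.snd.comp (Computable.unpair.comp Computable.snd)
    have hA : Partrec fun x : List Bool × ℕ => a.eval (lookup x.1) x.2.unpair.1 :=
      iha.comp (Computable.fst.pair hl)
    have hB : Partrec₂ fun (x : List Bool × ℕ) (y : ℕ × ℕ) =>
        b.eval (lookup x.1) (Nat.pair x.2.unpair.1 (Nat.pair y.1 y.2)) := by
      have h : Computable fun z : (List Bool × ℕ) × ℕ × ℕ =>
          (z.1.1, Nat.pair z.1.2.unpair.1 (Nat.pair z.2.1 z.2.2)) :=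
        (Computable.fst.comp Computable.fst).pair
          (Primrec₂.natPair.to_comp.comp (hl.comp Computable.fst)
            (Primrec₂.natPair.to_comp.comp (Computable.fst.comp Computable.snd)
              (Computable.snd.comp Computable.snd)))
      exact ihb.comp h
    exact (Partrec.nat_rec hr hA hB).of_eq fun x => rfl
  | rfind a iha =>
    have h : Computable fun z : (List Bool × ℕ) × ℕ => (z.1.1, Nat.pair z.1.2 z.2) :=
      (Computable.fst.comp Computable.fst).pair
        (Primrec₂.natPair.to_comp.comp (Computable.snd.comp Computable.fst) Computable.snd)
    have hd : Computable₂ fun (_ : (List Bool × ℕ) × ℕ) (v : ℕ) => decide (v = 0) :=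
      (Primrec.eq.decide.to_comp.comp Computable.snd (Computable.const 0) :
        Computable fun y : ((List Bool × ℕ) × ℕ) × ℕ => decide (y.2 = 0))
    have hA : Partrec₂ fun (x : List Bool × ℕ) (n : ℕ) =>
        (a.eval (lookup x.1) (Nat.pair x.2 n)).map fun v => decide (v = 0) :=
      Partrec.map (iha.comp h) hd
    exact (Partrec.rfind hA).of_eq fun x => rfl

/-- Partial recursive functions are partial recursive in every oracle. -/
theorem recursiveIn_of_partrec {O : ℕ → ℕ} {f : ℕ →. ℕ} (h : Nat.Partrec f) : RecursiveIn O f := by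
  induction h with
  | zero => exact .zero
  | succ => exact .succ
  | left => exact .left
  | right => exact .right
  | pair _ _ ha hb => exact .pair ha hb
  | comp _ _ ha hb => exact .comp ha hb
  | prec _ _ ha hb => exact .prec ha hb
  | rfind _ ha => exact .rfind ha

/-! ### Level-preserving maps between trees -/

section Trees

/-- `h` maps the tree `S` to the tree `T`, preserving length and immediate predecessors. -/
def IsTreeHom (S T : List ℕ → Prop) (h : List ℕ → List ℕ) : Prop :=
  ∀ s, S s → T (h s) ∧ (h s).length = s.length ∧ h s.dropLast = (h s).dropLast

theorem pre_succ (f : ℕ → ℕ) (k : ℕ) : pre f (k + 1) = pre f k ++ [f k] := by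
  simp [pre, List.range_succ]

theorem IsTreeHom.exists_path {S T : List ℕ → Prop} {h : List ℕ → List ℕ} (hh : IsTreeHom S T h)
    (hS : ∃ f, ∀ k, S (pre f k)) : ∃ f, ∀ k, T (pre f k) := by
  obtain ⟨f, hf⟩ := hS
  let g : ℕ → ℕ := fun k => (h (pre f (k + 1))).getD k 0
  have key : ∀ k, h (pre f k) = pre g k := by
    intro k
    induction k with
    | zero => exact List.length_eq_zero_iff.1 (by simpa using (hh _ (hf 0)).2.1)
    | succ k ih =>
      obtain ⟨-, hl, hd⟩ := hh _ (hf (k + 1))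
      rw [pre_succ f, List.dropLast_concat, ih, ← pre_succ] at hd
      rw [pre_succ g, hd]
      have hne : h (pre f (k + 1)) ≠ [] := by
        intro h0; simp [h0] at hl
      conv_lhs => rw [← List.dropLast_append_getLast hne]
      congr 2
      rw [List.getLast_eq_getElem]
      simp [g, hl]
  exact ⟨g, fun k => key k ▸ (hh _ (hf k)).1⟩

/-- `t` is a child of `s` in the tree `S`. -/
def IsChild (S : List ℕ → Prop) (t s : List ℕ) : Prop := S t ∧ ∃ x, t = s ++ [x]

theorem wellFounded_isChild {S : List ℕ → Prop} (hS : ∀ s, S s → ∀ i, S (s.take i))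
    (hw : ¬ ∃ f, ∀ k, S (pre f k)) : WellFounded (IsChild S) := by
  rw [wellFounded_iff_isEmpty_descending_chain]
  refine ⟨fun ⟨g, hg⟩ => hw ?_⟩
  have hlen : ∀ n, n ≤ (g n).length := by
    intro n
    induction n with
    | zero => simp
    | succ n ih =>
      obtain ⟨-, x, hx⟩ := hg n
      rw [hx]; simpa using ih
  have hpre : ∀ m n, m ≤ n → g m <+: g n := by
    intro m n hmn
    induction hmn with
    | refl => exact List.prefix_rfl
    | step _ ih =>
      obtain ⟨-, x, hx⟩ := hg _
      exact ih.trans (hx ▸ List.prefix_append _ _)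
  refine ⟨fun i => (g (i + 1)).getD i 0, fun k => ?_⟩
  have : pre (fun i => (g (i + 1)).getD i 0) k = (g (k + 1)).take k := by
    apply List.ext_getElem
    · have := hlen (k + 1)
      simp; omega
    · intro i h1 h2
      simp only [length_pre] at h1
      have hi : i < (g (i + 1)).length := hlen (i + 1)
      simp [pre, hi, (hpre (i + 1) (k + 1) (by omega)).getElem hi]
  rw [this]
  exact hS _ (hg k).1 _

open Classical in
/-- Follow, along a reversed sequence, the greedy strategy that picks a child of the current node
of large enough rank. -/
noncomputable def greedyMap (good : List ℕ → List ℕ → Prop) : List ℕ → List ℕ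
  | [] => []
  | x :: r =>
    greedyMap good r ++ [if h : ∃ y, good (r.reverse ++ [x]) (greedyMap good r ++ [y])
      then h.choose else 0]

theorem exists_isTreeHom_of_strategy {S T : List ℕ → Prop} (hS : ∀ s, S s → ∀ i, S (s.take i))
    {good : List ℕ → List ℕ → Prop} (h0 : good [] []) (hT : ∀ s t, good s t → T t)
    (hstep : ∀ s t x, good s t → S (s ++ [x]) → ∃ y, good (s ++ [x]) (t ++ [y])) :
    ∃ h, IsTreeHom S T h := by
  refine ⟨fun s => greedyMap good s.reverse, fun s hs => ?_⟩
  have hgood : ∀ r : List ℕ, S r.reverse → good r.reverse (greedyMap good r) := by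
    intro r
    induction r with
    | nil => exact fun _ => h0
    | cons x r ih =>
      intro h
      rw [List.reverse_cons] at h ⊢
      have hr : S r.reverse := by simpa using hS _ h r.length
      have := hstep _ _ x (ih hr) h
      rw [greedyMap, dif_pos this]
      exact this.choose_spec
  have hlen : ∀ r : List ℕ, (greedyMap good r).length = r.length := by
    intro r
    induction r with
    | nil => rfl
    | cons x r ih => simp [greedyMap, ih]
  refine ⟨hT s _ (by simpa using hgood s.reverse (by simpa using hs)), by simp [hlen], ?_⟩
  obtain rfl | ⟨s, x, rfl⟩ := s.eq_nil_or_concat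
  · rfl
  · simp [greedyMap]

theorem exists_isTreeHom_or {S T : List ℕ → Prop} (hS : ∀ s, S s → ∀ i, S (s.take i))
    (hT : ∀ s, T s → ∀ i, T (s.take i)) :
    (∃ h, IsTreeHom S T h) ∨ ∃ h, IsTreeHom T S h := by
  have const {S T : List ℕ → Prop} (h : ∃ f, ∀ k, T (pre f k)) : ∃ h, IsTreeHom S T h := by
    obtain ⟨f, hf⟩ := h
    refine ⟨fun s => pre f s.length, fun s _ => ⟨hf _, by simp, ?_⟩⟩
    simp only [List.dropLast_eq_take, length_pre, take_pre (Nat.sub_le s.length 1)]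
    simp
  have empty {S T : List ℕ → Prop} (hS : ∀ s, S s → ∀ i, S (s.take i)) (h : ¬ S []) :
      ∃ h, IsTreeHom S T h := ⟨id, fun s hs => absurd (by simpa using hS s hs 0) h⟩
  by_cases hpT : ∃ f, ∀ k, T (pre f k)
  · exact .inl (const hpT)
  by_cases hpS : ∃ f, ∀ k, S (pre f k)
  · exact .inr (const hpS)
  by_cases hS0 : S []
  swap; · exact .inl (empty hS hS0)
  by_cases hT0 : T []
  swap; · exact .inr (empty hT hT0)
  have rank {S T : List ℕ → Prop} (hS : ∀ s, S s → ∀ i, S (s.take i)) (hT0 : T [])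
      (hwS : IsWellFounded _ (IsChild S)) (hwT : IsWellFounded _ (IsChild T))
      (h : IsWellFounded.rank (IsChild S) [] ≤ IsWellFounded.rank (IsChild T) []) :
      ∃ h, IsTreeHom S T h := by
    refine exists_isTreeHom_of_strategy hS (good := fun s t => T t ∧
      IsWellFounded.rank (IsChild S) s ≤ IsWellFounded.rank (IsChild T) t) ⟨hT0, h⟩
      (fun s t h => h.1) fun s t x ⟨_, hle⟩ hx => ?_
    have h1 := (IsWellFounded.rank_lt_of_rel (r := IsChild S) ⟨hx, x, rfl⟩).trans_le hle
    rw [IsWellFounded.rank_eq (IsChild T) t, Ordinal.lt_iSup_iff] at h1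
    obtain ⟨⟨_, hy, y, rfl⟩, h2⟩ := h1
    exact ⟨y, hy, Order.lt_succ_iff.1 h2⟩
  have hwS : IsWellFounded _ (IsChild S) := ⟨wellFounded_isChild hS hpS⟩
  have hwT : IsWellFounded _ (IsChild T) := ⟨wellFounded_isChild hT hpT⟩
  obtain h | h := le_total (IsWellFounded.rank (IsChild S) []) (IsWellFounded.rank (IsChild T) [])
  · exact .inl (rank hS hT0 hwS hwT h)
  · exact .inr (rank hT hS0 hwT hwS h)

end Trees

/-! ### A computable tree whose paths diagonalize against hyperarithmetic functions -/

section Diagonal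

/-- Every initial segment of `l` satisfies `p`. -/
def AllPrefixes (p : List ℕ → Prop) (l : List ℕ) : Prop := ∀ i < l.length + 1, p (l.take i)

theorem AllPrefixes.take {p : List ℕ → Prop} {l : List ℕ} (h : AllPrefixes p l) (i : ℕ) :
    AllPrefixes p (l.take i) := by
  intro j hj
  rw [List.length_take] at hj
  rw [List.take_take, min_eq_left (by omega)]
  exact h j (by omega)

theorem forall_allPrefixes {p : List ℕ → Prop} {f : ℕ → ℕ} :
    (∀ k, AllPrefixes p (pre f k)) ↔ ∀ k, p (pre f k) := by
  constructor
  · intro h k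
    simpa [take_pre] using h k k (by simp)
  · intro h k i hi
    rw [length_pre] at hi
    rw [take_pre (by omega)]
    exact h i

theorem computablePred_allPrefixes {α : Type} [Primcodable α] {p : α × List ℕ → Prop}
    (hp : ComputablePred p) :
    ComputablePred fun x : α × List ℕ => AllPrefixes (fun l => p (x.1, l)) x.2 := by
  refine computablePred_forall_lt (n := fun x : α × List ℕ => x.2.length + 1)
    (r := fun y : (α × List ℕ) × ℕ => p (y.1.1, y.1.2.take y.2))
    (Computable.succ.comp (Primrec.list_length.to_comp.comp Computable.snd)) ?_
  exact computablePred_comp hp ((Computable.fst.comp Computable.fst).pair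
    (Primrec.list_take.to_comp.comp Computable.snd (Computable.snd.comp Computable.fst)))


/-- The program with index `x.1.1` does not reject, in the number of steps given by the length of
`x.2`, the initial segment of `x.2` given by that length, with parameter `x.1.2`. -/
def NotRejected (x : (ℕ × ℕ) × List ℕ) : Prop :=
  Code.evaln x.2.length.unpair.2 (Denumerable.ofNat Code x.1.1)
    (Encodable.encode (x.1.2, x.2.take x.2.length.unpair.1)) ≠ some 0

theorem computablePred_notRejected : ComputablePred NotRejected := by
  have hl : Computable fun x : (ℕ × ℕ) × List ℕ => x.2.length.unpair :=
    Computable.unpair.comp (Primrec.list_length.to_comp.comp Computable.snd)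
  have hc : Computable fun x : (ℕ × ℕ) × List ℕ => Denumerable.ofNat Code x.1.1 :=
    (Computable.ofNat Code).comp (Computable.fst.comp Computable.fst)
  have hi : Computable fun x : (ℕ × ℕ) × List ℕ =>
      Encodable.encode (x.1.2, x.2.take x.2.length.unpair.1) :=
    Computable.encode.comp ((Computable.snd.comp Computable.fst).pair
      (Primrec.list_take.to_comp.comp (Computable.fst.comp hl) Computable.snd))
  have hev := Code.primrec_evaln.to_comp.comp (((Computable.snd.comp hl).pair hc).pair hi)
  exact (computablePred_eq hev (Computable.const (some 0))).not.of_eq fun x => Iff.rfl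

/-- The tree with index `c` and parameter `a`. -/
def univTree (c a : ℕ) : List ℕ → Prop := AllPrefixes fun l => NotRejected ((c, a), l)

theorem Sig.exists_univTree {A : ℕ → Prop} (h : Sig A) :
    ∃ c, ∀ a, A a ↔ ∃ f, ∀ k, univTree c a (pre f k) := by
  obtain ⟨R, hR, e⟩ := h
  obtain ⟨χ, hχ, eχ⟩ := computablePred_iff.1 hR
  obtain ⟨c, hc⟩ := Code.exists_code.1 hχ
  refine ⟨Encodable.encode c, fun a => (e a).trans (exists_congr fun f => ?_)⟩
  have hval (j : ℕ) : R (a, pre f j) ↔ 0 ∉ c.eval (Encodable.encode (a, pre f j)) := by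
    rw [hc, eχ]
    cases hb : χ (a, pre f j) <;> simp [hb]
  simp only [univTree, forall_allPrefixes, hval, NotRejected, length_pre, Code.evaln_complete,
    not_exists, Denumerable.ofNat_encode]
  constructor
  · intro H k
    rw [take_pre (Nat.unpair_left_le k)]
    exact H _ _
  · intro H j m
    have := H (Nat.pair j m)
    rw [Nat.unpair_pair, take_pre (Nat.left_le_pair j m)] at this
    exact this

/-- The points at which instance `k` of the definition of `diagTree` reads a path. -/
def diagPoints (k : ℕ) : List ℕ :=
  [k.unpair.1, k, Nat.pair k.unpair.1
    (Encodable.encode (Denumerable.ofNat (List ℕ) k.unpair.2).dropLast)]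

/-- The value `v` of a path, as a node of a tree. -/
def nodeOf (v : ℕ) : List ℕ := Denumerable.ofNat (List ℕ) v.unpair.2

/-- The tree homomorphism condition at the node `s`, where `u` and `w` are the images of `s` and of
its immediate predecessor. -/
def HomAt (c d e : ℕ) (s u w : List ℕ) : Prop :=
  univTree c e s → univTree d e u ∧ u.length = s.length ∧ w = u.dropLast

/-- Instance `k` of the definition of `diagTree`, for the values `l` at `diagPoints k`. -/
def DiagCond (x : Unit × ℕ × List ℕ) : Prop :=
  let e := x.2.1.unpair.1
  let s := Denumerable.ofNat (List ℕ) x.2.1.unpair.2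
  let u := nodeOf (x.2.2.getD 1 0)
  let w := nodeOf (x.2.2.getD 2 0)
  ((x.2.2.getD 0 0).unpair.1 = 0 → HomAt e.unpair.1 e.unpair.2 e s u w) ∧
    ((x.2.2.getD 0 0).unpair.1 ≠ 0 → HomAt e.unpair.2 e.unpair.1 e s u w)

theorem primrec_dropLast : Primrec (List.dropLast : List ℕ → List ℕ) :=
  (Primrec.list_take.comp (Primrec.nat_sub.comp Primrec.list_length (Primrec.const 1))
    Primrec.id).of_eq fun _ => (List.dropLast_eq_take).symm

theorem computable_diagPoints : Computable diagPoints := by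
  have h1 : Primrec fun k : ℕ => k.unpair.1 := Primrec.fst.comp Primrec.unpair
  have h2 : Primrec fun k : ℕ => k.unpair.2 := Primrec.snd.comp Primrec.unpair
  refine (Primrec.list_cons.comp h1 (Primrec.list_cons.comp Primrec.id
    (Primrec.list_cons.comp (Primrec₂.natPair.comp h1 (Primrec.encode.comp (primrec_dropLast.comp
      ((Primrec.ofNat (List ℕ)).comp h2)))) (Primrec.const [])))).to_comp

theorem computablePred_homAt {α : Type} [Primcodable α] {c d e : α → ℕ} {s u w : α → List ℕ}
    (hc : Computable c) (hd : Computable d) (he : Computable e) (hs : Computable s)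
    (hu : Computable u) (hw : Computable w) :
    ComputablePred fun x => HomAt (c x) (d x) (e x) (s x) (u x) (w x) := by
  have hT := computablePred_allPrefixes computablePred_notRejected
  exact computablePred_imp (computablePred_comp hT ((hc.pair he).pair hs))
    (computablePred_and (computablePred_comp hT ((hd.pair he).pair hu))
      (computablePred_and (computablePred_eq (Primrec.list_length.to_comp.comp hu)
        (Primrec.list_length.to_comp.comp hs))
        (computablePred_eq hw (primrec_dropLast.to_comp.comp hu))))

theorem computablePred_diagCond : ComputablePred DiagCond := by
  have hk : Computable fun x : Unit × ℕ × List ℕ => x.2.1.unpair :=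
    Computable.unpair.comp (Computable.fst.comp Computable.snd)
  have he : Computable fun x : Unit × ℕ × List ℕ => x.2.1.unpair.1 := Computable.fst.comp hk
  have hs : Computable fun x : Unit × ℕ × List ℕ => Denumerable.ofNat (List ℕ) x.2.1.unpair.2 :=
    (Computable.ofNat (List ℕ)).comp (Computable.snd.comp hk)
  have hv (i : ℕ) : Computable fun x : Unit × ℕ × List ℕ => (x.2.2.getD i 0).unpair :=
    Computable.unpair.comp ((Primrec.list_getD 0).to_comp.comp
      (Computable.snd.comp Computable.snd) (Computable.const i))
  have hn (i : ℕ) : Computable fun x : Unit × ℕ × List ℕ => nodeOf (x.2.2.getD i 0) :=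
    (Computable.ofNat (List ℕ)).comp (Computable.snd.comp (hv i))
  have h0 : ComputablePred fun x : Unit × ℕ × List ℕ => (x.2.2.getD 0 0).unpair.1 = 0 :=
    computablePred_eq (Computable.fst.comp (hv 0)) (Computable.const 0)
  have hl := Computable.fst.comp (Computable.unpair.comp he)
  have hr := Computable.snd.comp (Computable.unpair.comp he)
  exact computablePred_and (computablePred_imp h0 (computablePred_homAt hl hr he hs (hn 1) (hn 2)))
    (computablePred_imp h0.not (computablePred_homAt hr hl he hs (hn 1) (hn 2)))

/-- A tree whose paths choose, for every pair of trees in the universal list, a homomorphism from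
one of them to the other. -/
def diagTree : Set (List ℕ) :=
  {l | AllPrefixes (fun s => LocalCheck diagPoints DiagCond ((), s)) l}

theorem computableTree_diagTree : ComputableTree diagTree := by
  constructor
  · intro l hl l' h
    rw [List.prefix_iff_eq_take.1 h]
    exact AllPrefixes.take (p := fun s => LocalCheck diagPoints DiagCond ((), s)) hl _
  · obtain ⟨χ, h, e⟩ := computablePred_iff.1 (computablePred_allPrefixes
      (computablePred_localCheck computable_diagPoints computablePred_diagCond))
    exact ⟨_, h.comp ((Computable.const ()).pair Computable.id), fun l => e ((), l)⟩

theorem isPath_diagTree {y : ℕ → ℕ} : IsPath diagTree y ↔ ∀ e,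
    ((y e).unpair.1 = 0 → IsTreeHom (univTree e.unpair.1 e) (univTree e.unpair.2 e)
      fun s => nodeOf (y (Nat.pair e (Encodable.encode s)))) ∧
    ((y e).unpair.1 ≠ 0 → IsTreeHom (univTree e.unpair.2 e) (univTree e.unpair.1 e)
      fun s => nodeOf (y (Nat.pair e (Encodable.encode s)))) := by
  have h := (forall_allPrefixes (p := fun s => LocalCheck diagPoints DiagCond ((), s))
    (f := y)).trans forall_localCheck
  refine Iff.trans h ?_
  constructor
  · intro H e
    constructor <;> intro h s
    · simpa [diagPoints, HomAt] using (H (Nat.pair e (Encodable.encode s))).1 (by simpa [diagPoints] using h)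
    · simpa [diagPoints, HomAt] using (H (Nat.pair e (Encodable.encode s))).2 (by simpa [diagPoints] using h)
  · intro H k
    constructor <;> intro h
    · simpa [diagPoints, HomAt] using (H k.unpair.1).1 (by simpa [diagPoints] using h)
        (Denumerable.ofNat (List ℕ) k.unpair.2)
    · simpa [diagPoints, HomAt] using (H k.unpair.1).2 (by simpa [diagPoints] using h)
        (Denumerable.ofNat (List ℕ) k.unpair.2)

theorem illFounded_diagTree : IllFounded diagTree := by
  have (e : ℕ) : ∃ b h, (b = 0 → IsTreeHom (univTree e.unpair.1 e) (univTree e.unpair.2 e) h) ∧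
      (b ≠ 0 → IsTreeHom (univTree e.unpair.2 e) (univTree e.unpair.1 e) h) := by
    obtain ⟨h, hh⟩ | ⟨h, hh⟩ := exists_isTreeHom_or
      (S := univTree e.unpair.1 e) (T := univTree e.unpair.2 e)
      (fun s hs i => hs.take i) fun s hs i => hs.take i
    · exact ⟨0, h, fun _ => hh, fun h => absurd rfl h⟩
    · exact ⟨1, h, fun h => absurd h one_ne_zero, fun _ => hh⟩
  choose b h hh using this
  refine ⟨fun n => Nat.pair (b n)
    (Encodable.encode (h n.unpair.1 (Denumerable.ofNat (List ℕ) n.unpair.2))),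
    isPath_diagTree.2 fun e => ?_⟩
  simpa [nodeOf] using hh e

theorem exists_ne_of_delta {g : ℕ → ℕ} (hg : Delta fun x : ℕ × ℕ => g x.1 = x.2) :
    ∃ e, ∀ y, IsPath diagTree y → y e ≠ g e := by
  have hbit : Sig fun x : ℕ × ℕ => x.2.unpair.1 = 0 := sig_of_computablePred
    (computablePred_eq (Computable.fst.comp (Computable.unpair.comp Computable.snd))
      (Computable.const 0))
  have hbit' : Sig fun x : ℕ × ℕ => x.2.unpair.1 ≠ 0 := sig_of_computablePred
    (computablePred_eq (Computable.fst.comp (Computable.unpair.comp Computable.snd))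
      (Computable.const 0)).not
  obtain ⟨c, hc⟩ := (((hg.1.and hbit).exists).of_iff
    (B := fun e => (g e).unpair.1 = 0) fun e => by simp).exists_univTree
  obtain ⟨d, hd⟩ := (((hg.1.and hbit').exists).of_iff
    (B := fun e => (g e).unpair.1 ≠ 0) fun e => by simp).exists_univTree
  refine ⟨Nat.pair c d, fun y hy hye => ?_⟩
  obtain ⟨h1, h2⟩ := isPath_diagTree.1 hy (Nat.pair c d)
  rw [hye] at h1 h2
  rw [Nat.unpair_pair] at h1 h2
  by_cases h : (g (Nat.pair c d)).unpair.1 = 0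
  · exact (hd _).2 ((h1 h).exists_path ((hc _).1 h)) h
  · exact h ((hc _).2 ((h2 h).exists_path ((hd _).1 h)))

end Diagonal

/-! ### The ill-founded part of a linear order -/

namespace LinOrd

/-- `y` starts a descending sequence in `L`. -/
def IllPart (L : LinOrd) (y : ℕ) : Prop := ∃ g, IsDescSeq L g ∧ g 0 = y

variable {L : LinOrd} {y z b : ℕ}

theorem IllPart.mem_dom (h : L.IllPart y) : y ∈ L.dom := by
  obtain ⟨g, hg, rfl⟩ := h
  exact (hg 0).1

theorem IllPart.mono (hL : L.IsValid) (h : L.IllPart y) (hyz : L.lt y z) : L.IllPart z := by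
  obtain ⟨g, hg, rfl⟩ := h
  refine ⟨fun n => n.casesOn z g, fun i => ?_, rfl⟩
  cases i with
  | zero => exact ⟨(hL.1 _ _ hyz).2, hyz⟩
  | succ i => exact hg i

theorem IllPart.lt_of_not (hL : L.IsValid) (h : L.IllPart y) (hb : b ∈ L.dom)
    (hn : ¬ L.IllPart b) : L.lt b y := by
  obtain rfl | h1 | h1 := hL.2.2.2 b hb y h.mem_dom
  · exact absurd h hn
  · exact h1
  · exact absurd (h.mono hL h1) hn

theorem lt_of_isDescSeq (hL : L.IsValid) {g : ℕ → ℕ} (hg : IsDescSeq L g) {m n : ℕ} (h : m < n) :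
    L.lt (g n) (g m) := by
  induction h with
  | refl => exact (hg m).2
  | step _ ih => exact hL.2.2.1 _ _ _ (hg _).2 ih

theorem injective_of_isDescSeq (hL : L.IsValid) {g : ℕ → ℕ} (hg : IsDescSeq L g) :
    Function.Injective g := by
  intro m n hmn
  by_contra hne
  obtain h | h := Nat.lt_or_gt_of_ne hne <;>
  · have := lt_of_isDescSeq hL hg h
    exact hL.2.1 _ (hmn ▸ this)

theorem IllPart.exists_lt (hL : L.IsValid) (h : L.IllPart y) (d : ℕ) :
    ∃ z, L.lt z y ∧ L.IllPart z ∧ d ≤ z := by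
  obtain ⟨g, hg, rfl⟩ := h
  obtain ⟨_, ⟨n, rfl⟩, hn⟩ := (Set.infinite_range_of_injective
    ((injective_of_isDescSeq hL hg).comp Nat.succ_injective)).exists_gt d
  exact ⟨_, lt_of_isDescSeq hL hg n.succ_pos,
    ⟨fun i => g (n + 1 + i), fun i => hg _, rfl⟩, hn.le⟩

theorem sig_illPart (hL : ComputableLinOrd L) : Sig L.IllPart := by
  obtain ⟨-, ⟨χ, hχ, eχ⟩, ρ, hρ, eρ⟩ := hL
  have hv (i : ℕ) : Computable fun x : ℕ × ℕ × List ℕ => x.2.2.getD i 0 :=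
    (Primrec.list_getD 0).to_comp.comp (Computable.snd.comp Computable.snd) (Computable.const i)
  have hP : Computable fun k : ℕ => [0, k, k + 1] :=
    (Primrec.list_cons.comp (Primrec.const 0) (Primrec.list_cons.comp Primrec.id
      (Primrec.list_cons.comp Primrec.succ (Primrec.const [])))).to_comp
  have hR : ComputablePred fun x : ℕ × ℕ × List ℕ => (x.2.2.getD 1 0 ∈ L.dom ∧
      L.lt (x.2.2.getD 2 0) (x.2.2.getD 1 0)) ∧ x.2.2.getD 0 0 = x.1 := by
    refine computablePred_and (computablePred_and ?_ ?_) (computablePred_eq (hv 0) Computable.fst)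
    · exact computablePred_iff.2 ⟨_, hχ.comp (hv 1), fun _ => eχ _⟩
    · exact computablePred_iff.2 ⟨_, hρ.comp (hv 2) (hv 1), fun _ => eρ _ _⟩
  refine sig_of_points hP hR fun y => exists_congr fun g => ?_
  simp [IsDescSeq, forall_and]

end LinOrd

/-! ### Forcing with strings and finitely many restricted columns -/

section Forcing

/-- `τ` extends `σ`, and all new elements of `τ` belong to `M`. -/
def ExtIn (M : ℕ → Prop) (σ τ : List Bool) : Prop :=
  σ <+: τ ∧ ∀ m, σ.length ≤ m ∧ τ[m]? = some true → M m

theorem ExtIn.mono {M M' : ℕ → Prop} {σ τ : List Bool} (h : ExtIn M σ τ) (hM : ∀ m, M m → M' m) :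
    ExtIn M' σ τ := ⟨h.1, fun m hm => hM m (h.2 m hm)⟩

theorem ExtIn.refl (M : ℕ → Prop) (σ : List Bool) : ExtIn M σ σ :=
  ⟨List.prefix_rfl, fun m ⟨h, h'⟩ => by simp [List.getElem?_eq_none h] at h'⟩

theorem getElem?_of_prefix {σ τ : List Bool} (h : σ <+: τ) {m : ℕ} {b : Bool}
    (hb : σ[m]? = some b) : τ[m]? = some b := by
  obtain ⟨ρ, rfl⟩ := h
  rw [List.getElem?_append_left (List.getElem?_eq_some_iff.1 hb).1, hb]

theorem ExtIn.trans {M : ℕ → Prop} {σ τ ρ : List Bool} (h : ExtIn M σ τ) (h' : ExtIn M τ ρ) :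
    ExtIn M σ ρ := by
  refine ⟨h.1.trans h'.1, fun m ⟨hm, hρ⟩ => ?_⟩
  obtain hl | hl := le_or_gt τ.length m
  · exact h'.2 m ⟨hl, hρ⟩
  · have h1 := getElem?_of_prefix h'.1 (List.getElem?_eq_getElem hl)
    refine h.2 m ⟨hm, ?_⟩
    rw [List.getElem?_eq_getElem hl, ← h1, hρ]

/-- Some string extending `σ` with new elements from `M` makes program `c` output `v` on `e`. -/
def Reach (σ : List Bool) (c : OCode) (M : ℕ → Prop) (e v : ℕ) : Prop :=
  ∃ τ, ExtIn M σ τ ∧ v ∈ c.eval (lookup τ) e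

/-- `Reach` holds with some output on every input. -/
def TotalReach (σ : List Bool) (c : OCode) (M : ℕ → Prop) : Prop := ∀ e, ∃ v, Reach σ c M e v

theorem TotalReach.mono {σ : List Bool} {c : OCode} {M M' : ℕ → Prop} (h : TotalReach σ c M)
    (hM : ∀ m, M m → M' m) : TotalReach σ c M' := fun e =>
  let ⟨v, τ, hτ, hv⟩ := h e
  ⟨v, τ, hτ.mono hM, hv⟩

section Complexity

variable {α : Type} [Primcodable α] {M : α × ℕ → Prop}

theorem computablePred_isPrefix (σ : List Bool) : ComputablePred fun τ : List Bool => σ <+: τ :=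
  (computablePred_eq (Computable.const σ) (Primrec.list_take.to_comp.comp
    (Computable.const σ.length) Computable.id)).of_eq fun _ => List.prefix_iff_eq_take.symm

theorem computablePred_newElement (σ : List Bool) :
    ComputablePred fun x : (α × List Bool) × ℕ => σ.length ≤ x.2 ∧ x.1.2[x.2]? = some true :=
  computablePred_and (computablePred_le (Computable.const _) Computable.snd)
    (computablePred_eq (Computable.list_getElem?.comp (Computable.snd.comp Computable.fst)
      Computable.snd) (Computable.const (some true)))

theorem Sig.extIn (hM : Sig M) (σ : List Bool) :
    Sig fun x : α × List Bool => ExtIn (fun m => M (x.1, m)) σ x.2 := by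
  have h : Sig fun y : (α × List Bool) × ℕ =>
      (σ.length ≤ y.2 ∧ y.1.2[y.2]? = some true) → M (y.1.1, y.2) :=
    ((sig_of_computablePred (computablePred_newElement σ).not).or
      (hM.comp ((Computable.fst.comp Computable.fst).pair Computable.snd))).of_iff
        fun _ => imp_iff_not_or
  exact (sig_of_computablePred (computablePred_comp (computablePred_isPrefix σ)
    Computable.snd)).and h.forall

theorem Delta.extIn (hM : Delta M) (σ : List Bool) :
    Delta fun x : α × List Bool => ExtIn (fun m => M (x.1, m)) σ x.2 :=
  (delta_of_computablePred (computablePred_comp (computablePred_isPrefix σ)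
    Computable.snd)).and ((delta_of_computablePred (computablePred_newElement σ)).imp
      (hM.comp ((Computable.fst.comp Computable.fst).pair Computable.snd))).forall

theorem delta_mem_eval_lookup (c : OCode) :
    Delta fun y : (α × ℕ × ℕ) × List Bool => y.1.2.2 ∈ c.eval (lookup y.2) y.1.2.1 :=
  (delta_mem_partrec (partrec_eval_lookup c)).comp
    (f := fun y : (α × ℕ × ℕ) × List Bool => ((y.2, y.1.2.1), y.1.2.2))
    ((Computable.snd.pair (Computable.fst.comp (Computable.snd.comp Computable.fst))).pair
      (Computable.snd.comp (Computable.snd.comp Computable.fst)))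

theorem Sig.reach (hM : Sig M) (σ : List Bool) (c : OCode) :
    Sig fun x : α × ℕ × ℕ => Reach σ c (fun m => M (x.1, m)) x.2.1 x.2.2 :=
  (((hM.extIn σ).comp ((Computable.fst.comp Computable.fst).pair Computable.snd)).and
    (delta_mem_eval_lookup c).1).exists

theorem Delta.reach (hM : Delta M) (σ : List Bool) (c : OCode) :
    Delta fun x : α × ℕ × ℕ => Reach σ c (fun m => M (x.1, m)) x.2.1 x.2.2 :=
  (((hM.extIn σ).comp ((Computable.fst.comp Computable.fst).pair Computable.snd)).and
    (delta_mem_eval_lookup c)).exists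

theorem Sig.totalReach (hM : Sig M) (σ : List Bool) (c : OCode) :
    Sig fun a => TotalReach σ c fun m => M (a, m) :=
  ((hM.reach σ c).comp (f := fun y : (α × ℕ) × ℕ => (y.1.1, y.1.2, y.2))
    ((Computable.fst.comp Computable.fst).pair
      ((Computable.snd.comp Computable.fst).pair Computable.snd))).exists.forall

end Complexity

theorem Delta.or {α : Type} [Primcodable α] {A B : α → Prop} (hA : Delta A) (hB : Delta B) :
    Delta fun a => A a ∨ B a := (hA.not.imp hB).of_iff fun a => by tauto

variable {L : ℕ → LinOrd}

/-- The elements that respect the promise to enumerate only elements of the ill-founded part into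
the first `k` columns. -/
def Allowed (L : ℕ → LinOrd) (k m : ℕ) : Prop := m.unpair.1 < k → (L m.unpair.1).IllPart m.unpair.2

theorem Allowed.anti {k k' m : ℕ} (h : Allowed L k' m) (hk : k ≤ k') : Allowed L k m :=
  fun hm => h (hm.trans_le hk)

theorem computable_unpair_fst : Computable fun m : ℕ => m.unpair.1 :=
  Computable.fst.comp Computable.unpair

theorem computable_unpair_snd : Computable fun m : ℕ => m.unpair.2 :=
  Computable.snd.comp Computable.unpair

theorem sig_allowed (hL : ∀ i, ComputableLinOrd (L i)) (k : ℕ) : Sig (Allowed L k) := by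
  induction k with
  | zero =>
    exact (sig_of_computablePred (computablePred_eq Computable.id Computable.id)).of_iff
      fun m => by simp [Allowed]
  | succ k ih =>
    have hk := computablePred_eq computable_unpair_fst (Computable.const k)
    refine (ih.and ((sig_of_computablePred hk.not).or
      ((LinOrd.sig_illPart (hL k)).comp computable_unpair_snd))).of_iff fun m => ?_
    simp only [Allowed, Nat.lt_succ_iff_lt_or_eq]
    constructor
    · intro h
      refine ⟨fun h' => h (.inl h'), ?_⟩
      by_cases hm : m.unpair.1 = k
      · exact .inr (hm ▸ h (.inr hm))
      · exact .inl hm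
    · rintro ⟨h, h'⟩ (hm | hm)
      · exact h hm
      · subst hm; exact h'.resolve_left (by simp)

/-- Replace column `j` of `M` by the final segment of `L j` that starts with `b`. -/
def cutColumn (L : ℕ → LinOrd) (M : ℕ → Prop) (j b m : ℕ) : Prop :=
  (m.unpair.1 ≠ j ∧ M m) ∨ (m.unpair.1 = j ∧ (m.unpair.2 = b ∨ (L j).lt b m.unpair.2))

theorem computablePred_column (hL : ∀ i, ComputableLinOrd (L i)) (j : ℕ) :
    ComputablePred fun x : ℕ × ℕ => x.2.unpair.1 = j ∧
      (x.2.unpair.2 = x.1 ∨ (L j).lt x.1 x.2.unpair.2) := by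
  obtain ⟨-, -, ρ, hρ, eρ⟩ := hL j
  have hs := computable_unpair_snd.comp (Computable.snd (α := ℕ) (β := ℕ))
  exact computablePred_and (computablePred_eq (computable_unpair_fst.comp Computable.snd)
    (Computable.const j)) (computablePred_or (computablePred_eq hs Computable.fst)
      (computablePred_iff.2 ⟨_, hρ.comp Computable.fst hs, fun _ => eρ _ _⟩))

theorem sig_cutColumn (hL : ∀ i, ComputableLinOrd (L i)) {M : ℕ → Prop} (hM : Sig M) (j : ℕ) :
    Sig fun x : ℕ × ℕ => cutColumn L M j x.1 x.2 :=
  ((sig_of_computablePred (computablePred_eq (computable_unpair_fst.comp Computable.snd)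
    (Computable.const j)).not).and (hM.comp Computable.snd)).or
      (sig_of_computablePred (computablePred_column hL j))

/-- If totality can be forced, it can be forced by means of a set with hyperarithmetic first `j`
columns. -/
theorem exists_totalReach_columns (hL : ∀ i, ComputableLinOrd (L i)) {σ : List Bool} {c : OCode}
    {k : ℕ} (h : TotalReach σ c (Allowed L k)) {j : ℕ} (hj : j ≤ k) :
    ∃ M : ℕ → Prop, (∀ m, M m → Allowed L k m) ∧ Sig M ∧
      Delta (fun m => M m ∧ m.unpair.1 < j) ∧
      (∀ m, j ≤ m.unpair.1 → Allowed L k m → M m) ∧ TotalReach σ c M := by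
  induction j with
  | zero =>
    exact ⟨_, fun _ => id, sig_allowed hL k, (delta_of_computablePred
      (computablePred_eq Computable.id Computable.id).not).of_iff fun m => by simp,
      fun _ _ => id, h⟩
  | succ j ih =>
    obtain ⟨M, hMA, hMs, hMd, hMe, hMt⟩ := ih (by omega)
    have hval := (hL j).1
    have hcol : ∀ m, M m → m.unpair.1 = j → (L j).IllPart m.unpair.2 := by
      intro m hm e
      have := hMA m hm (by omega)
      rwa [e] at this
    have hlast : ∀ {m : ℕ}, m.unpair.1 < j + 1 ↔ m.unpair.1 < j ∨ m.unpair.1 = j :=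
      Nat.lt_succ_iff_lt_or_eq
    by_cases hb : ∃ b, (L j).IllPart b ∧ TotalReach σ c (cutColumn L M j b)
    · obtain ⟨b, hb, ht⟩ := hb
      refine ⟨cutColumn L M j b, ?_, (sig_cutColumn hL hMs j).comp ((Computable.const b).pair Computable.id), ?_,
        ?_, ht⟩
      · rintro m (⟨-, hm⟩ | ⟨e, hm⟩)
        · exact hMA m hm
        · intro _
          rw [e]
          obtain hm | hm := hm
          · exact hm ▸ hb
          · exact hb.mono hval hm
      · refine (hMd.or (delta_of_computablePred (computablePred_comp (computablePred_column hL j)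
          ((Computable.const b).pair Computable.id)))).of_iff fun m => ?_
        simp only [cutColumn, hlast, id]
        constructor
        · rintro ⟨⟨h1, h2⟩ | h1, h3⟩
          · exact .inl ⟨h2, h3.resolve_right h1⟩
          · exact .inr h1
        · rintro (⟨h1, h2⟩ | h1)
          · exact ⟨.inl ⟨h2.ne, h1⟩, .inl h2⟩
          · exact ⟨.inr h1, .inr h1.1⟩
      · exact fun m hm ha => .inl ⟨by omega, hMe m (by omega) ha⟩
    · refine ⟨M, hMA, hMs, ?_, fun m hm => hMe m (by omega), hMt⟩
      have hN : ∀ y, ¬ (L j).IllPart y ↔ y ∉ (L j).dom ∨ TotalReach σ c (cutColumn L M j y) := by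
        intro y
        constructor
        · intro hy
          by_cases hd : y ∈ (L j).dom
          · refine .inr (hMt.mono fun m hm => ?_)
            by_cases e : m.unpair.1 = j
            · exact .inr ⟨e, .inr ((hcol m hm e).lt_of_not hval hd hy)⟩
            · exact .inl ⟨e, hm⟩
          · exact .inl hd
        · rintro (h | h) hy
          · exact h hy.mem_dom
          · exact hb ⟨y, hy, h⟩
      have hdom : ComputablePred fun y => y ∉ (L j).dom := by
        obtain ⟨-, ⟨χ, hχ, eχ⟩, -⟩ := hL j
        exact (computablePred_iff.2 ⟨χ, hχ, eχ⟩).not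
      have hd : Delta (L j).IllPart := ⟨LinOrd.sig_illPart (hL j),
        ((sig_of_computablePred hdom).or ((sig_cutColumn hL hMs j).totalReach σ c)).of_iff hN⟩
      refine (hMd.or ((delta_of_computablePred (computablePred_eq computable_unpair_fst
        (Computable.const j))).and (hd.comp computable_unpair_snd))).of_iff fun m => ?_
      rw [hlast]
      constructor
      · rintro ⟨h1, h2 | h2⟩
        · exact .inl ⟨h1, h2⟩
        · exact .inr ⟨h2, hcol m h1 h2⟩
      · rintro (⟨h1, h2⟩ | ⟨h1, h2⟩)
        · exact ⟨h1, .inl h2⟩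
        · exact ⟨hMe m h1.ge fun _ => h1.symm ▸ h2, .inr h1⟩

theorem exists_delta_of_totalReach (hL : ∀ i, ComputableLinOrd (L i)) {σ : List Bool} {c : OCode}
    {k : ℕ} (h : TotalReach σ c (Allowed L k)) :
    ∃ g : ℕ → ℕ, Delta (fun x : ℕ × ℕ => g x.1 = x.2) ∧ ∀ e, Reach σ c (Allowed L k) e (g e) := by
  classical
  obtain ⟨M, hMA, -, hMd, hMe, hMt⟩ := exists_totalReach_columns hL h le_rfl
  have hM : Delta M := (hMd.or (delta_of_computablePred (computablePred_le (Computable.const k)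
    computable_unpair_fst))).of_iff fun m => by
      constructor
      · intro hm
        obtain hk | hk := lt_or_ge m.unpair.1 k
        · exact .inl ⟨hm, hk⟩
        · exact .inr hk
      · rintro (h | h)
        · exact h.1
        · exact hMe m h fun h' => absurd h' (by omega)
  have hR : Delta fun x : ℕ × ℕ => Reach σ c M x.1 x.2 :=
    ((hM.comp (Computable.snd (α := Unit))).reach σ c).comp
      ((Computable.const ()).pair Computable.id)
  refine ⟨fun e => Nat.find (hMt e), ?_, fun e => ?_⟩
  · have hlt : Delta fun y : (ℕ × ℕ) × ℕ => y.2 < y.1.2 := delta_of_computablePred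
      (computablePred_lt Computable.snd (Computable.snd.comp Computable.fst))
    exact (hR.and (hlt.imp (hR.comp ((Computable.fst.comp Computable.fst).pair
      Computable.snd)).not).forall).of_iff fun x => Nat.find_eq_iff (hMt x.1)
  · obtain ⟨τ, hτ, hv⟩ := Nat.find_spec (hMt e)
    exact ⟨τ, hτ.mono hMA, hv⟩

/-- The condition `q` extends the condition `p`. A condition `(σ, k)` is an initial segment `σ` of
the generic set with a promise on the first `k` columns. -/
def Extends (L : ℕ → LinOrd) (q p : List Bool × ℕ) : Prop :=
  ExtIn (Allowed L p.2) p.1 q.1 ∧ p.2 ≤ q.2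

theorem Extends.refl (p : List Bool × ℕ) : Extends L p p := ⟨ExtIn.refl _ _, le_rfl⟩

theorem Extends.trans {r q p : List Bool × ℕ} (h : Extends L r q) (h' : Extends L q p) :
    Extends L r p := ⟨h'.1.trans (h.1.mono fun _ hm => hm.anti h'.2), h'.2.trans h.2⟩

/-- The condition `q` forces that program `c` does not compute a path of `diagTree`. -/
def Kills (L : ℕ → LinOrd) (c : OCode) (q : List Bool × ℕ) : Prop :=
  (∃ e, ∀ r, Extends L r q → ∀ v, v ∉ c.eval (lookup r.1) e) ∨
    ∃ e, ∃ v ∈ c.eval (lookup q.1) e, ∀ y, IsPath diagTree y → y e ≠ v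

theorem exists_kills (hL : ∀ i, ComputableLinOrd (L i)) (c : OCode) (p : List Bool × ℕ) :
    ∃ q, Extends L q p ∧ Kills L c q := by
  by_cases h : TotalReach p.1 c (Allowed L p.2)
  · obtain ⟨g, hg, hr⟩ := exists_delta_of_totalReach hL h
    obtain ⟨e, he⟩ := exists_ne_of_delta hg
    obtain ⟨τ, hτ, hv⟩ := hr e
    exact ⟨(τ, p.2), ⟨hτ, le_rfl⟩, .inr ⟨e, _, hv, he⟩⟩
  · simp only [TotalReach, not_forall, not_exists] at h
    obtain ⟨e, he⟩ := h
    exact ⟨p, Extends.refl p, .inl ⟨e, fun r hr v hv => he v ⟨r.1, hr.1, hv⟩⟩⟩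

theorem exists_extends_length (p : List Bool × ℕ) (n : ℕ) :
    ∃ q, Extends L q p ∧ n ≤ q.2 ∧ n ≤ q.1.length := by
  refine ⟨(p.1 ++ List.replicate n false, p.2 + n), ⟨⟨List.prefix_append _ _, ?_⟩, by simp⟩,
    by simp, by simp⟩
  rintro m ⟨hm, h⟩
  rw [List.getElem?_append_right hm] at h
  simpa using List.mem_of_getElem? h

theorem exists_extends_below (hL : ∀ i, (L i).IsValid) (p : List Bool × ℕ) {i y : ℕ}
    (hy : (L i).IllPart y) (d : ℕ) :
    ∃ q, Extends L q p ∧ ∃ z, (L i).lt z y ∧ d ≤ Nat.pair i z ∧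
      q.1[Nat.pair i z]? = some true := by
  obtain ⟨z, hzy, hz, hd⟩ := hy.exists_lt (hL i) (max d p.1.length)
  have hzp := Nat.right_le_pair i z
  refine ⟨(p.1 ++ List.replicate (Nat.pair i z - p.1.length) false ++ [true], p.2),
    ⟨⟨⟨_, (List.append_assoc _ _ _).symm⟩, ?_⟩, le_rfl⟩, z, hzy, by omega, ?_⟩
  · rintro m ⟨hm, h⟩
    obtain hlt | hge := lt_or_ge m (Nat.pair i z)
    · rw [List.append_assoc, List.getElem?_append_right hm,
        List.getElem?_append_left (by simp; omega)] at h
      simpa using List.mem_of_getElem? h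
    · have : m = Nat.pair i z := by
        have := (List.getElem?_eq_some_iff.1 h).1
        simp at this
        omega
      subst this
      intro _
      simpa using hz
  · rw [List.getElem?_append_right (by simp; omega)]
    simp [show p.1.length + (Nat.pair i z - p.1.length) = Nat.pair i z by omega]

theorem exists_generic_sequence {ι : Type} [Countable ι] [Nonempty ι]
    {D : ι → List Bool × ℕ → Prop} (hD : ∀ a p, ∃ q, Extends L q p ∧ D a q) :
    ∃ p : ℕ → List Bool × ℕ, (∀ m n, m ≤ n → Extends L (p n) (p m)) ∧ ∀ a, ∃ n, D a (p n) := by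
  obtain ⟨s, hs⟩ := exists_surjective_nat ι
  choose F hF using hD
  refine ⟨fun n => Nat.rec ([], 0) (fun n p => F (s n) p) n, fun m n h => ?_, fun a => ?_⟩
  · induction h with
    | refl => exact Extends.refl _
    | step _ ih => exact (hF _ _).1.trans ih
  · obtain ⟨n, rfl⟩ := hs a
    exact ⟨n + 1, (hF _ _).2⟩

theorem exists_generic (hL : ∀ i, ComputableLinOrd (L i)) : ∃ X : Set ℕ,
    (∀ i, ∃ d, (∀ y, d ≤ Nat.pair i y → Nat.pair i y ∈ X → (L i).IllPart y) ∧
      ∀ y, (L i).IllPart y → ∃ z, (L i).lt z y ∧ d ≤ Nat.pair i z ∧ Nat.pair i z ∈ X) ∧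
    ∀ c : OCode, ¬ ∃ f, IsPath diagTree f ∧ ∀ n, f n ∈ c.eval (chi X : ℕ →. ℕ) n := by
  have : Nonempty (OCode ⊕ (ℕ × ℕ × ℕ) ⊕ ℕ) := ⟨.inl .zero⟩
  obtain ⟨p, hp, hD⟩ := exists_generic_sequence (L := L) (ι := OCode ⊕ (ℕ × ℕ × ℕ) ⊕ ℕ)
    (D := Sum.elim (Kills L) (Sum.elim
      (fun a q => (L a.1).IllPart a.2.1 → ∃ z, (L a.1).lt z a.2.1 ∧ a.2.2 ≤ Nat.pair a.1 z ∧
        q.1[Nat.pair a.1 z]? = some true)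
      fun n q => n ≤ q.2 ∧ n ≤ q.1.length)) <| by
    rintro (c | a | n) q
    · exact exists_kills hL c q
    · by_cases h : (L a.1).IllPart a.2.1
      · obtain ⟨r, hr, hz⟩ := exists_extends_below (fun i => (hL i).1) q h a.2.2
        exact ⟨r, hr, fun _ => hz⟩
      · exact ⟨q, Extends.refl q, fun h' => absurd h' h⟩
    · exact exists_extends_length q n
  have hstable : ∀ {m n k b}, m ≤ n → (p m).1[k]? = some b → (p n).1[k]? = some b :=
    fun h hb => getElem?_of_prefix (hp _ _ h).1.1 hb
  let X : Set ℕ := {m | ∃ n, (p n).1[m]? = some true}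
  have hchi : ∀ {n m b}, (p n).1[m]? = some b → chi X m = b.toNat := by
    intro n m b hb
    cases b with
    | true => exact if_pos ⟨n, hb⟩
    | false =>
      refine if_neg fun ⟨n', hn'⟩ => ?_
      have h1 := hstable (le_max_left n n') hb
      rw [hstable (le_max_right n n') hn'] at h1
      simp at h1
  refine ⟨X, fun i => ?_, ?_⟩
  · obtain ⟨n, hn, -⟩ := hD (.inr (.inr (i + 1)))
    refine ⟨(p n).1.length, fun y hy ⟨n', hn'⟩ => ?_, fun y hy => ?_⟩
    · have := (hp n _ (le_max_left n n')).1.2 _ ⟨hy, hstable (le_max_right n n') hn'⟩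
      simpa using this (by simpa using hn)
    · obtain ⟨n', hn'⟩ := hD (.inr (.inl (i, y, (p n).1.length)))
      obtain ⟨z, hz, hd, h⟩ := hn' hy
      exact ⟨z, hz, hd, n', h⟩
  · rintro c ⟨f, hf, hc⟩
    obtain ⟨n, ⟨e, he⟩ | ⟨e, v, hv, he⟩⟩ := hD (.inl c)
    · obtain ⟨s, hs⟩ := c.exists_use (hc e)
      obtain ⟨n', -, hn'⟩ := hD (.inr (.inr s))
      refine he _ (hp n _ (le_max_left n n')) _ (hs _ fun m hm => ?_)
      have h1 := hstable (le_max_right n n')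
        (List.getElem?_eq_getElem (show m < (p n').1.length from hm.trans_le hn'))
      simp [lookup, hchi h1, h1]
    · refine he f hf (Part.mem_unique (hc e) (OCode.eval_mono (fun m u hu => ?_) c hv))
      simp only [lookup, Part.mem_ofOption, Option.mem_def, Option.map_eq_some_iff] at hu
      obtain ⟨b, hb, rfl⟩ := hu
      simp [hchi hb]

end Forcing

/-! ### Tight descending sequences from coinitial columns -/

section Greedy

variable {O : ℕ → ℕ}

theorem RecursiveIn.of_computable {f : ℕ → ℕ} (hf : Computable f) :
    RecursiveIn O (f : ℕ →. ℕ) := recursiveIn_of_partrec (Partrec.nat_iff.1 hf)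

theorem RecursiveIn.comp_total {f g : ℕ → ℕ} (hf : RecursiveIn O (f : ℕ →. ℕ))
    (hg : RecursiveIn O (g : ℕ →. ℕ)) : RecursiveIn O (fun n => f (g n) : ℕ → ℕ) := by
  have h := hf.comp hg
  have e : (fun n => (g : ℕ →. ℕ) n >>= (f : ℕ →. ℕ)) = ((fun n => f (g n) : ℕ → ℕ) : ℕ →. ℕ) := by
    funext n; exact (Part.bind_some _ _).trans rfl
  rwa [e] at h

theorem RecursiveIn.pair_total {f g : ℕ → ℕ} (hf : RecursiveIn O (f : ℕ →. ℕ))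
    (hg : RecursiveIn O (g : ℕ →. ℕ)) : RecursiveIn O (fun n => Nat.pair (f n) (g n) : ℕ → ℕ) := by
  have h := hf.pair hg
  have e : (fun n => Nat.pair <$> (f : ℕ →. ℕ) n <*> (g : ℕ →. ℕ) n) =
      ((fun n => Nat.pair (f n) (g n) : ℕ → ℕ) : ℕ →. ℕ) := by
    funext n; simp [Seq.seq]
  rwa [e] at h

theorem RecursiveIn.of_step {R : ℕ →. ℕ} (hR : RecursiveIn O R) {F : ℕ → ℕ}
    (hF : ∀ n, F (n + 1) ∈ R (F n)) : RecursiveIn O (F : ℕ →. ℕ) := by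
  have hs : RecursiveIn O fun n => (fun n : ℕ => n.unpair.2.unpair.2 : ℕ →. ℕ) n >>= R :=
    hR.comp (of_computable (Computable.snd.comp (Computable.unpair.comp
      (Computable.snd.comp Computable.unpair))))
  have hp : RecursiveIn O ((fun n => Nat.pair 0 n : ℕ → ℕ) : ℕ →. ℕ) :=
    of_computable (Primrec₂.natPair.to_comp.comp (Computable.const 0) Computable.id)
  have h := (RecursiveIn.prec (of_computable (Computable.const (F 0))) hs).comp hp
  refine cast (congrArg (RecursiveIn O) (funext fun n => Part.eq_some_iff.2 ?_)) h
  refine Part.mem_bind_iff.2 ⟨Nat.pair 0 n, Part.mem_some _, ?_⟩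
  simp only [Nat.unpaired, Nat.unpair_pair]
  induction n with
  | zero => exact Part.mem_some _
  | succ n ih =>
    refine Part.mem_bind_iff.2 ⟨_, ih, Part.mem_bind_iff.2 ⟨F n, ?_, hF n⟩⟩
    simp

open Classical in
theorem exists_recursiveIn_search {p : ℕ → ℕ → Prop} {t : ℕ → ℕ} (ht : RecursiveIn O (t : ℕ →. ℕ))
    (htp : ∀ x z, t (Nat.pair x z) = 0 ↔ p x z) :
    ∃ R, RecursiveIn O R ∧ ∀ x (h : ∃ z, p x z), Nat.find h ∈ R x := by
  refine ⟨_, ht.rfind, fun x h => Nat.mem_rfind.2 ⟨?_, fun {m} hm => ?_⟩⟩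
  · simpa [htp] using Nat.find_spec h
  · simpa [htp] using Nat.find_min h hm

/-- If from some point on column `i` of `X` is a coinitial subset of the ill-founded part of `L`,
then `X` computes a tight descending sequence. -/
theorem exists_isTightDescSeq {L : LinOrd} (hL : ComputableLinOrd L) (hill : L.IllFounded)
    {X : Set ℕ} {i d : ℕ} (hsub : ∀ y, d ≤ Nat.pair i y → Nat.pair i y ∈ X → L.IllPart y)
    (hcoin : ∀ y, L.IllPart y → ∃ z, L.lt z y ∧ d ≤ Nat.pair i z ∧ Nat.pair i z ∈ X) :
    ∃ f : ℕ → ℕ, ComputableIn (chi X) f ∧ IsTightDescSeq L f := by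
  classical
  let p : ℕ → ℕ → Prop := fun x z => L.lt z x ∧ d ≤ Nat.pair i z ∧ Nat.pair i z ∈ X
  have hdec : ComputablePred fun n : ℕ =>
      (L.lt n.unpair.2.unpair.2 n.unpair.2.unpair.1 ∧ d ≤ Nat.pair i n.unpair.2.unpair.2) ∧
        n.unpair.1 = 1 := by
    obtain ⟨-, -, ρ, hρ, eρ⟩ := hL
    have hr := computable_unpair_snd.comp computable_unpair_snd
    have hl := computable_unpair_fst.comp computable_unpair_snd
    exact computablePred_and (computablePred_and
      (computablePred_iff.2 ⟨_, hρ.comp hr hl, fun _ => eρ _ _⟩)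
      (computablePred_le (Computable.const d) (Primrec₂.natPair.to_comp.comp
        (Computable.const i) hr))) (computablePred_eq computable_unpair_fst (Computable.const 1))
  obtain ⟨χ, hχ, eχ⟩ := computablePred_iff.1 hdec
  have hcol : RecursiveIn (chi X) ((fun n => Nat.pair i n.unpair.2 : ℕ → ℕ) : ℕ →. ℕ) :=
    .of_computable (Primrec₂.natPair.to_comp.comp (Computable.const i) computable_unpair_snd)
  have htest : RecursiveIn (chi X) ((fun n => bif χ n then 0 else 1 : ℕ → ℕ) : ℕ →. ℕ) :=
    .of_computable (Computable.cond hχ (Computable.const 0) (Computable.const 1))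
  obtain ⟨R, hR, hRp⟩ := exists_recursiveIn_search (p := p) (htest.comp_total
    ((RecursiveIn.oracle.comp_total hcol).pair_total (.of_computable Computable.id))) fun x z => by
      have := eχ (Nat.pair (chi X (Nat.pair i z)) (Nat.pair x z))
      have hX : chi X (Nat.pair i z) = 1 ↔ Nat.pair i z ∈ X := by simp [chi]
      simp only [Nat.unpair_pair, hX] at this
      simp only [p, Nat.unpair_pair, id, ← and_assoc, this]
      cases χ (Nat.pair (chi X (Nat.pair i z)) (Nat.pair x z)) <;> simp
  obtain ⟨g, hg⟩ := hill
  have hp (y : ℕ) (hy : L.IllPart y) : ∃ z, p y z := hcoin y hy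
  let next : {x // L.IllPart x} → {x // L.IllPart x} := fun x =>
    ⟨Nat.find (hp x x.2), hsub _ (Nat.find_spec (hp x x.2)).2.1
      (Nat.find_spec (hp x x.2)).2.2⟩
  let F : ℕ → {x // L.IllPart x} := fun n => Nat.rec ⟨g 0, g, hg, rfl⟩ (fun _ x => next x) n
  have hstep (n : ℕ) : (F (n + 1) : ℕ) = Nat.find (hp (F n).1 (F n).2) := rfl
  have hlt (n : ℕ) : L.lt (F (n + 1)).1 (F n).1 := by
    rw [hstep]
    exact (Nat.find_spec (hp (F n).1 (F n).2)).1
  have hdesc : IsDescSeq L fun n => (F n).1 := fun n => ⟨(F n).2.mem_dom, hlt n⟩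
  refine ⟨fun n => (F n).1, RecursiveIn.computableIn (hR.of_step fun n => ?_),
    hdesc, fun h hh n => ?_⟩
  · rw [hstep]
    convert hRp (F n).1 (hp (F n).1 (F n).2)
  by_contra! hnot
  obtain ⟨z, hz, hzd, hzX⟩ := hcoin (h n) ⟨fun k => h (n + k), fun k => hh _, rfl⟩
  have hle (m : ℕ) : (F (m + 1) : ℕ) ≤ z := by
    rw [hstep]
    refine Nat.find_min' _ ⟨?_, hzd, hzX⟩
    obtain e | e | e := hL.1.2.2.2 _ (hh n).1 _ (F m).2.mem_dom
    · exact e ▸ hz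
    · exact hL.1.2.2.1 _ _ _ hz e
    · exact absurd e (hnot m)
  exact Set.infinite_range_of_injective
    ((LinOrd.injective_of_isDescSeq hL.1 hdesc).comp Nat.succ_injective)
    ((Set.finite_Iic z).subset (Set.range_subset_iff.2 hle))

end Greedy

/-! ### Enumerating the ill-founded computable linear orders -/

theorem exists_eq_linOrdOfCodes {L : LinOrd} (hL : ComputableLinOrd L) :
    ∃ n, linOrdOfCodes n = L := by
  obtain ⟨-, ⟨χ, hχ, eχ⟩, ρ, hρ, eρ⟩ := hL
  have hb : Computable Bool.toNat := (Primrec.dom_finite _).to_comp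
  obtain ⟨c, hc⟩ := Code.exists_code.1 (Partrec.nat_iff.1 (hb.comp hχ).partrec)
  obtain ⟨r, hr⟩ := Code.exists_code.1 (Partrec.nat_iff.1
    (hb.comp (hρ.comp computable_unpair_fst computable_unpair_snd)).partrec)
  refine ⟨Nat.pair (Encodable.encode c) (Encodable.encode r), ?_⟩
  obtain ⟨D, lt⟩ := L
  simp only [linOrdOfCodes, codeFn, Nat.unpair_pair, Denumerable.ofNat_encode, hc, hr]
  congr
  · ext a
    simp
    exact (eχ a).symm
  · funext a b
    simpa using (eρ a b).symm

/-- The natural numbers in reversed order. -/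
def reversedNat : LinOrd := ⟨Set.univ, fun a b => b < a⟩

theorem computableLinOrd_reversedNat : ComputableLinOrd reversedNat := by
  refine ⟨⟨fun _ _ _ => ⟨trivial, trivial⟩, fun a => lt_irrefl a, fun a b c h h' => lt_trans h' h,
    fun a _ b _ => ?_⟩, ⟨fun _ => true, Computable.const true, fun _ => by simp [reversedNat]⟩,
    fun a b => decide (b < a), ?_, fun a b => by simp [reversedNat]⟩
  · obtain h | h | h := lt_trichotomy a b
    exacts [.inr (.inr h), .inl h, .inr (.inl h)]
  · exact Primrec.nat_lt.decide.to_comp.comp Computable.snd Computable.fst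

theorem illFounded_reversedNat : reversedNat.IllFounded :=
  ⟨id, fun i => ⟨trivial, Nat.lt_succ_self i⟩⟩

theorem exists_enumeration_linOrd : ∃ L : ℕ → LinOrd,
    (∀ i, ComputableLinOrd (L i) ∧ (L i).IllFounded) ∧
      ∀ K, ComputableLinOrd K → K.IllFounded → ∃ i, L i = K := by
  classical
  refine ⟨fun i => if ComputableLinOrd (linOrdOfCodes i) ∧ (linOrdOfCodes i).IllFounded
    then linOrdOfCodes i else reversedNat, fun i => ?_, fun K hK hill => ?_⟩
  · dsimp only
    split_ifs with h
    · exact h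
    · exact ⟨computableLinOrd_reversedNat, illFounded_reversedNat⟩
  · obtain ⟨i, rfl⟩ := exists_eq_linOrdOfCodes hK
    exact ⟨i, if_pos ⟨hK, hill⟩⟩

/-- There is a set that is high for tight descending sequences but not
high for paths. -/
theorem exists_highForTightDS_not_highForPaths :
    ∃ X : Set ℕ, HighForTightDS X ∧
      ∃ T : Set (List ℕ), ComputableTree T ∧ IllFounded T ∧
        ¬ ∃ f : ℕ → ℕ, ComputableIn (chi X) f ∧ IsPath T f := by
  obtain ⟨L, hL, henum⟩ := exists_enumeration_linOrd
  obtain ⟨X, hcol, hkill⟩ := exists_generic fun i => (hL i).1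
  refine ⟨X, fun K hK hill => ?_, diagTree, computableTree_diagTree, illFounded_diagTree, ?_⟩
  · obtain ⟨i, rfl⟩ := henum K hK hill
    obtain ⟨d, hsub, hcoin⟩ := hcol i
    exact exists_isTightDescSeq hK hill hsub hcoin
  · rintro ⟨f, hf, hp⟩
    obtain ⟨c, hc⟩ := hf.recursiveIn.exists_oCode
    exact hkill c ⟨f, hp, fun n => by simp [hc]⟩

end CFT
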